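/- arXiv:1903.01053 — 3 statements merged into one kernel-verified Lean document; each statement's English description precedes it below -/
import Mathlib

section
/- Let t > 1 and let k be a positive integer with tk a positive integer. Let A : ℝ^{n₁×n₂} → ℝ^m be a linear map satisfying the RIP of order tk with restricted isometry constant δ := δ_{tk} ∈ (0,1). Let H ∈ ℝ^{n₁×n₂} and E ⊆ {1,…,n₁} with |E| = k; set α = ‖H_{E^c}‖_*/((t−1)k) and E₁ = {i ∈ E^c : σ_i(H) > α}. Then (1−δ²)‖H_{E∪E₁}‖_F² − 2√(1+δ)·‖A(H)‖₂·‖H_{E∪E₁}‖_F − (δ²/((t−1)k))·‖H_{E^c}‖_*² ≤ 0, and consequently ‖H_{E∪E₁}‖_F ≤ [2/((1−δ)√(1+δ))]·‖A(H)‖₂ + [δ/√((1−δ²)(t−1))]·‖H_{E^c}‖_*/√k. -/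
open Finset

/-- Frobenius norm of a real matrix. -/
noncomputable def frobNorm {n₁ n₂ : ℕ} (M : Matrix (Fin n₁) (Fin n₂) ℝ) : ℝ :=
  Real.sqrt (∑ i, ∑ j, M i j ^ 2)

/-- Nuclear norm of a real matrix: sum of its singular values, i.e. of the
square roots of the eigenvalues of `M * Mᵀ`. -/
noncomputable def nucNorm {n₁ n₂ : ℕ} (M : Matrix (Fin n₁) (Fin n₂) ℝ) : ℝ :=
  ∑ i, Real.sqrt ((Matrix.isHermitian_mul_conjTranspose_self M).eigenvalues i)

/-- `A` satisfies the RIP of order `r` with constant `δ`. -/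
def HasRIP {n₁ n₂ m : ℕ} (A : Matrix (Fin n₁) (Fin n₂) ℝ →ₗ[ℝ] EuclideanSpace ℝ (Fin m))
    (r : ℕ) (δ : ℝ) : Prop :=
  ∀ M : Matrix (Fin n₁) (Fin n₂) ℝ, M.rank ≤ r →
    (1 - δ) * frobNorm M ^ 2 ≤ ‖A M‖ ^ 2 ∧ ‖A M‖ ^ 2 ≤ (1 + δ) * frobNorm M ^ 2

/-- The rank-one matrix `s • u vᵀ`. -/
noncomputable def rank1 {n₁ n₂ : ℕ} (s : ℝ) (u : Fin n₁ → ℝ) (v : Fin n₂ → ℝ) :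
    Matrix (Fin n₁) (Fin n₂) ℝ :=
  Matrix.of fun a b => s * u a * v b

/-- A threshold selecting at most `N` of the smallest nonpositive values of `c` on `S`. -/
theorem exists_threshold_subset {ι : Type*} [DecidableEq ι] (S : Finset ι) (c : ι → ℝ) (N : ℕ) :
    ∃ T ⊆ S, T.card ≤ N ∧ ∃ τ ≤ (0 : ℝ), (∀ i ∈ T, c i ≤ τ) ∧ (∀ i ∈ S \ T, τ ≤ c i) ∧
      (τ = 0 ∨ T.card = N) := by
  induction N with
  | zero =>
    rcases S.eq_empty_or_nonempty with rfl | hS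
    · exact ⟨∅, by simp, by simp, 0, le_rfl, by simp⟩
    · obtain ⟨i, -, hi⟩ := S.exists_min_image c hS
      refine ⟨∅, by simp, by simp, min 0 (c i), min_le_left _ _, by simp, ?_, by simp⟩
      intro j hj
      exact (min_le_right _ _).trans (hi j (by simpa using hj))
  | succ N ih =>
    obtain ⟨T, hTS, hTN, τ, hτ, hT, hST, hτN⟩ := ih
    by_cases hneg : ∀ i ∈ S \ T, 0 ≤ c i
    · exact ⟨T, hTS, by omega, 0, le_rfl, fun i hi => (hT i hi).trans hτ, hneg, Or.inl rfl⟩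
    · push Not at hneg
      obtain ⟨j, hj, hcj⟩ := hneg
      obtain ⟨i, hi, hmin⟩ := (S \ T).exists_min_image c ⟨j, hj⟩
      have hci : c i < 0 := (hmin j hj).trans_lt hcj
      have hcard : T.card = N := hτN.resolve_left fun h => by
        have := hST i hi
        linarith
      obtain ⟨hiS, hiT⟩ := Finset.mem_sdiff.1 hi
      refine ⟨insert i T, Finset.insert_subset hiS hTS, ?_, c i, hci.le, ?_, ?_, Or.inr ?_⟩
      · rw [Finset.card_insert_of_notMem hiT, hcard]
      · intro l hl
        rcases Finset.mem_insert.1 hl with rfl | hl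
        · exact le_rfl
        · exact (hT l hl).trans (hST i hi)
      · intro l hl
        simp only [Finset.mem_sdiff, Finset.mem_insert, not_or] at hl
        exact hmin l (Finset.mem_sdiff.2 ⟨hl.1, hl.2.2⟩)
      · rw [Finset.card_insert_of_notMem hiT, hcard]

/-- A linear functional on `{0 ≤ y ≤ α, ∑ y ≤ N α}` is bounded below by its value at some
`α • 1_T` with `|T| ≤ N`. -/
theorem exists_subset_mul_sum_le {ι : Type*} [DecidableEq ι] (S : Finset ι) (c y : ι → ℝ)
    (N : ℕ) (α : ℝ) (hy0 : ∀ i ∈ S, 0 ≤ y i) (hyα : ∀ i ∈ S, y i ≤ α)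
    (hsum : ∑ i ∈ S, y i ≤ N * α) :
    ∃ T ⊆ S, T.card ≤ N ∧ ∑ i ∈ T, α * c i ≤ ∑ i ∈ S, y i * c i := by
  obtain ⟨T, hTS, hTN, τ, hτ, hT, hST, hτN⟩ := exists_threshold_subset S c N
  refine ⟨T, hTS, hTN, ?_⟩
  have h1 : ∑ i ∈ T, (y i - α) * τ ≤ ∑ i ∈ T, (y i - α) * c i :=
    Finset.sum_le_sum fun i hi =>
      mul_le_mul_of_nonpos_left (hT i hi) (by linarith [hyα i (hTS hi)])
  have h2 : ∑ i ∈ S \ T, y i * τ ≤ ∑ i ∈ S \ T, y i * c i :=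
    Finset.sum_le_sum fun i hi =>
      mul_le_mul_of_nonneg_left (hST i hi) (hy0 i (Finset.mem_sdiff.1 hi).1)
  have h3 := Finset.sum_sdiff hTS (f := fun i => y i * c i)
  have h4 := Finset.sum_sdiff hTS (f := y)
  have h5 : 0 ≤ (∑ i ∈ S, y i - T.card * α) * τ := by
    rcases hτN with h | h
    · simp [h]
    · rw [h]
      exact mul_nonneg_of_nonpos_of_nonpos (by linarith) hτ
  simp only [sub_mul, Finset.sum_sub_distrib, ← Finset.sum_mul, Finset.sum_const,
    nsmul_eq_mul] at h1 h2
  rw [← h4] at h5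
  linarith

theorem frobNorm_sq {n₁ n₂ : ℕ} (M : Matrix (Fin n₁) (Fin n₂) ℝ) :
    frobNorm M ^ 2 = ∑ i, ∑ j, M i j ^ 2 :=
  Real.sq_sqrt (by positivity)

theorem frobNorm_nonneg {n₁ n₂ : ℕ} (M : Matrix (Fin n₁) (Fin n₂) ℝ) : 0 ≤ frobNorm M :=
  Real.sqrt_nonneg _

/-- The matrix `∑ dᵢ uᵢ vᵢᵀ`, as a linear function of `d`. -/
noncomputable def rankOneComb {n₁ n₂ : ℕ} {ι : Type*} [Fintype ι] (u : ι → Fin n₁ → ℝ)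
    (v : ι → Fin n₂ → ℝ) : (ι → ℝ) →ₗ[ℝ] Matrix (Fin n₁) (Fin n₂) ℝ :=
  ∑ i, (LinearMap.proj i).smulRight (rank1 1 (u i) (v i))

theorem rank1_eq_smul {n₁ n₂ : ℕ} (s : ℝ) (u : Fin n₁ → ℝ) (v : Fin n₂ → ℝ) :
    rank1 s u v = s • rank1 1 u v := by
  ext a b
  simp [rank1, mul_assoc]

section RankOneComb

variable {n₁ n₂ : ℕ} {ι : Type*} [Fintype ι] (u : ι → Fin n₁ → ℝ) (v : ι → Fin n₂ → ℝ)

theorem rankOneComb_apply (d : ι → ℝ) :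
    rankOneComb u v d = ∑ i, d i • rank1 1 (u i) (v i) := by
  simp [rankOneComb]

theorem rankOneComb_indicator [DecidableEq ι] (T : Finset ι) (d : ι → ℝ) :
    rankOneComb u v (fun i => if i ∈ T then d i else 0) = ∑ i ∈ T, rank1 (d i) (u i) (v i) := by
  simp [rankOneComb_apply, ite_smul, ← rank1_eq_smul]

theorem frobNorm_rankOneComb_sq [DecidableEq ι]
    (hu : ∀ i j, ∑ a, u i a * u j a = if i = j then (1 : ℝ) else 0)
    (hv : ∀ i j, ∑ b, v i b * v j b = if i = j then (1 : ℝ) else 0) (d : ι → ℝ) :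
    frobNorm (rankOneComb u v d) ^ 2 = ∑ i, d i ^ 2 := by
  have h : ∀ a b, (rankOneComb u v d a b) ^ 2 =
      ∑ i, ∑ j, d i * d j * ((u i a * u j a) * (v i b * v j b)) := by
    intro a b
    rw [rankOneComb_apply, sq, Matrix.sum_apply, Finset.sum_mul_sum]
    refine Finset.sum_congr rfl fun i _ => Finset.sum_congr rfl fun j _ => ?_
    simp only [rank1, Matrix.smul_apply, Matrix.of_apply, smul_eq_mul]
    ring
  calc frobNorm (rankOneComb u v d) ^ 2
      = ∑ a, ∑ b, ∑ i, ∑ j, d i * d j * ((u i a * u j a) * (v i b * v j b)) := by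
        simp only [frobNorm_sq, h]
    _ = ∑ i, ∑ j, ∑ a, ∑ b, d i * d j * ((u i a * u j a) * (v i b * v j b)) := by
        simp_rw [Finset.sum_comm (s := (Finset.univ : Finset (Fin n₂)))]
        rw [Finset.sum_comm]
        refine Finset.sum_congr rfl fun i _ => ?_
        rw [Finset.sum_comm]
    _ = ∑ i, ∑ j, d i * d j * ((∑ a, u i a * u j a) * ∑ b, v i b * v j b) := by
        simp only [← Finset.mul_sum, Finset.sum_mul_sum]
    _ = ∑ i, d i ^ 2 := by
        simp [hu, hv, sq]

theorem rank_rank1_le (s : ℝ) (x : Fin n₁ → ℝ) (y : Fin n₂ → ℝ) : (rank1 s x y).rank ≤ 1 := by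
  have : rank1 s x y = Matrix.vecMulVec (s • x) y := by
    ext a b
    simp [rank1, Matrix.vecMulVec_apply]
  rw [this]
  exact Matrix.rank_vecMulVec_le _ _

theorem rank_matrix_add_le (M M' : Matrix (Fin n₁) (Fin n₂) ℝ) :
    (M + M').rank ≤ M.rank + M'.rank := by
  rw [Matrix.rank, Matrix.rank, Matrix.rank, Matrix.mulVecLin_add]
  exact (Submodule.finrank_mono (LinearMap.range_add_le _ _)).trans
    (Submodule.finrank_add_le_finrank_add_finrank _ _)

theorem rank_rankOneComb_le [DecidableEq ι] (T : Finset ι) (d : ι → ℝ)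
    (hd : ∀ i ∉ T, d i = 0) : (rankOneComb u v d).rank ≤ T.card := by
  have h : d = fun i => if i ∈ T then d i else 0 := by
    ext i
    by_cases hi : i ∈ T <;> simp [hi, hd]
  rw [h, rankOneComb_indicator]
  clear h hd
  induction T using Finset.induction_on with
  | empty => simp
  | insert i T hi ih =>
    rw [Finset.sum_insert hi, Finset.card_insert_of_notMem hi]
    have := rank_matrix_add_le (rank1 (d i) (u i) (v i)) (∑ i ∈ T, rank1 (d i) (u i) (v i))
    have := rank_rank1_le (d i) (u i) (v i)
    omega

end RankOneComb

/-- Polarization with weights `1 ± δ` and `δ`. -/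
theorem le_two_mul_norm_sq_add_inner {F : Type*} [NormedAddCommGroup F] [InnerProductSpace ℝ F]
    {a b : F} {δ x w : ℝ} (hδ : 0 < δ)
    (hlow : (1 - δ) * ((1 + δ) ^ 2 * x + δ ^ 2 * w) ≤ ‖(1 + δ) • a + δ • b‖ ^ 2)
    (hupp : ‖(1 - δ) • a - δ • b‖ ^ 2 ≤ (1 + δ) * ((1 - δ) ^ 2 * x + δ ^ 2 * w)) :
    (1 - δ ^ 2) * x - δ ^ 2 * w ≤ 2 * (‖a‖ ^ 2 + inner ℝ a b) := by
  rw [norm_add_sq_real] at hlow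
  rw [norm_sub_sq_real] at hupp
  simp only [norm_smul, inner_smul_left, inner_smul_right, mul_pow, Real.norm_eq_abs, sq_abs,
    conj_trivial] at hlow hupp
  refine le_of_mul_le_mul_left ?_ (show 0 < 2 * δ by positivity)
  linarith

theorem le_add_of_sq_le {x q r : ℝ} (hq : 0 ≤ q) (hr : 0 ≤ r) (h : x ^ 2 ≤ q * x + r ^ 2) :
    x ≤ q + r := by
  by_contra! hx
  nlinarith [mul_pos (show 0 < x - q - r by linarith) (show 0 < x by linarith),
    mul_nonneg hr (show 0 ≤ x - r by linarith)]

/-- Lower bound on the inner product with a bounded tail, for a map with the RIP. -/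
theorem HasRIP.le_two_mul_norm_sq_add_inner {n₁ n₂ m s N : ℕ}
    {A : Matrix (Fin n₁) (Fin n₂) ℝ →ₗ[ℝ] EuclideanSpace ℝ (Fin m)} {δ α : ℝ}
    (hδ : 0 < δ) (hRIP : HasRIP A s δ) {ι : Type*} [Fintype ι] [DecidableEq ι]
    {u : ι → Fin n₁ → ℝ} {v : ι → Fin n₂ → ℝ}
    (hu : ∀ i j, ∑ a, u i a * u j a = if i = j then (1 : ℝ) else 0)
    (hv : ∀ i j, ∑ b, v i b * v j b = if i = j then (1 : ℝ) else 0)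
    {σ : ι → ℝ} {P : Finset ι} (hP : P.card + N ≤ s)
    (h0 : ∀ i ∈ Pᶜ, 0 ≤ σ i) (hα : ∀ i ∈ Pᶜ, σ i ≤ α) (hsum : ∑ i ∈ Pᶜ, σ i ≤ N * α) :
    (1 - δ ^ 2) * frobNorm (∑ i ∈ P, rank1 (σ i) (u i) (v i)) ^ 2 - δ ^ 2 * (N * α ^ 2) ≤
      2 * inner ℝ (A (∑ i ∈ P, rank1 (σ i) (u i) (v i)))
        (A (∑ i, rank1 (σ i) (u i) (v i))) := by
  set X := ∑ i ∈ P, rank1 (σ i) (u i) (v i) with hX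
  obtain ⟨T, hTS, hTN, hT⟩ := exists_subset_mul_sum_le Pᶜ
    (fun i => inner ℝ (A X) (A (rank1 1 (u i) (v i)))) σ N α h0 hα hsum
  have hdisj : Disjoint P T := by
    rw [Finset.disjoint_left]
    intro i hi hiT
    exact Finset.mem_compl.1 (hTS hiT) hi
  set Z := ∑ i ∈ T, rank1 α (u i) (v i) with hZ
  have hXZ : inner ℝ (A X) (A Z) ≤ inner ℝ (A X) (A (∑ i ∈ Pᶜ, rank1 (σ i) (u i) (v i))) := by
    have hsmul : ∀ (Q : Finset ι) (d : ι → ℝ),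
        inner ℝ (A X) (A (∑ i ∈ Q, rank1 (d i) (u i) (v i))) =
          ∑ i ∈ Q, d i * inner ℝ (A X) (A (rank1 1 (u i) (v i))) := by
      intro Q d
      rw [map_sum A _ Q, inner_sum]
      refine Finset.sum_congr rfl fun i _ => ?_
      rw [rank1_eq_smul, map_smul, inner_smul_right]
    rw [hsmul Pᶜ σ, hZ, hsmul T fun _ => α]
    exact hT
  have hX' := rankOneComb_indicator u v P σ
  have hZ' := rankOneComb_indicator u v T fun _ => α
  rw [← hX] at hX'
  rw [← hZ] at hZ'
  have hcomb : ∀ p q : ℝ,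
      (p • X + q • Z).rank ≤ s ∧
        frobNorm (p • X + q • Z) ^ 2 = p ^ 2 * frobNorm X ^ 2 + q ^ 2 * (T.card * α ^ 2) := by
    intro p q
    rw [← hX', ← hZ', ← map_smul, ← map_smul, ← map_add]
    constructor
    · refine (rank_rankOneComb_le u v (P ∪ T) _ ?_).trans
        ((Finset.card_union_le _ _).trans (by omega))
      intro i hi
      simp only [Finset.mem_union, not_or] at hi
      simp [hi.1, hi.2]
    · rw [frobNorm_rankOneComb_sq u v hu hv, frobNorm_rankOneComb_sq u v hu hv]
      have : (T.card : ℝ) * α ^ 2 = ∑ i, (if i ∈ T then α else 0) ^ 2 := by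
        simp [ite_pow]
      rw [this, Finset.mul_sum, Finset.mul_sum, ← Finset.sum_add_distrib]
      refine Finset.sum_congr rfl fun i _ => ?_
      by_cases hi : i ∈ P
      · have : i ∉ T := Finset.disjoint_left.1 hdisj hi
        simp [hi, this, mul_pow]
      · simp [hi, mul_pow]
  have hlow := (hRIP _ (hcomb (1 + δ) δ).1).1
  have hupp := (hRIP _ (hcomb (1 - δ) (-δ)).1).2
  rw [(hcomb _ _).2, map_add, map_smul, map_smul] at hlow hupp
  rw [neg_sq, neg_smul, ← sub_eq_add_neg] at hupp
  have hpol := _root_.le_two_mul_norm_sq_add_inner hδ hlow hupp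
  have hsplit : inner ℝ (A X) (A (∑ i, rank1 (σ i) (u i) (v i))) =
      ‖A X‖ ^ 2 + inner ℝ (A X) (A (∑ i ∈ Pᶜ, rank1 (σ i) (u i) (v i))) := by
    rw [← Finset.sum_add_sum_compl P, map_add, inner_add_right, real_inner_self_eq_norm_sq]
  have hTα : δ ^ 2 * ((T.card : ℝ) * α ^ 2) ≤ δ ^ 2 * (N * α ^ 2) := by
    have : (T.card : ℝ) ≤ N := by exact_mod_cast hTN
    gcongr
  linarith

theorem stmt7 {n₁ n₂ m k : ℕ} (hk : 0 < k) (hn : n₁ ≤ n₂)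
    (t : ℝ) (ht : 1 < t) (s : ℕ) (hs : 0 < s) (hstk : (s : ℝ) = t * k)
    (A : Matrix (Fin n₁) (Fin n₂) ℝ →ₗ[ℝ] EuclideanSpace ℝ (Fin m))
    (δ : ℝ) (hδ0 : 0 < δ) (hδ1 : δ < 1)
    (hRIP : HasRIP A s δ)
    (H : Matrix (Fin n₁) (Fin n₂) ℝ)
    -- SVD of `H`, with singular values `σ` in decreasing order
    (σ : Fin n₁ → ℝ) (u : Fin n₁ → Fin n₁ → ℝ) (v : Fin n₁ → Fin n₂ → ℝ)
    (hσ0 : ∀ i, 0 ≤ σ i) (hσmono : ∀ i j : Fin n₁, i ≤ j → σ j ≤ σ i)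
    (hu : ∀ i j, ∑ a, u i a * u j a = if i = j then (1 : ℝ) else 0)
    (hv : ∀ i j, ∑ b, v i b * v j b = if i = j then (1 : ℝ) else 0)
    (hH : H = ∑ i, rank1 (σ i) (u i) (v i))
    (E : Finset (Fin n₁)) (hE : E.card = k)
    (α : ℝ) (hα : α = (∑ i ∈ Eᶜ, σ i) / ((t - 1) * k))
    (E₁ : Finset (Fin n₁)) (hE₁ : E₁ = Eᶜ.filter fun i => α < σ i) :
    (1 - δ ^ 2) * frobNorm (∑ i ∈ E ∪ E₁, rank1 (σ i) (u i) (v i)) ^ 2 -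
        2 * Real.sqrt (1 + δ) * ‖A H‖ * frobNorm (∑ i ∈ E ∪ E₁, rank1 (σ i) (u i) (v i)) -
        (δ ^ 2 / ((t - 1) * k)) * (∑ i ∈ Eᶜ, σ i) ^ 2 ≤ 0 ∧
      frobNorm (∑ i ∈ E ∪ E₁, rank1 (σ i) (u i) (v i)) ≤
        (2 / ((1 - δ) * Real.sqrt (1 + δ))) * ‖A H‖ +
          (δ / Real.sqrt ((1 - δ ^ 2) * (t - 1))) * (∑ i ∈ Eᶜ, σ i) / Real.sqrt k := by
  have hk' : (0 : ℝ) < k := by exact_mod_cast hk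
  have htk : 0 < (t - 1) * k := mul_pos (by linarith) hk'
  set B := ∑ i ∈ Eᶜ, σ i with hB
  have hB0 : 0 ≤ B := Finset.sum_nonneg fun i _ => hσ0 i
  have hBα : B = (t - 1) * k * α := by
    rw [hα, mul_div_cancel₀ _ htk.ne']
  have hα0 : 0 ≤ α := hα ▸ div_nonneg hB0 htk.le
  have hE₁sub : E₁ ⊆ Eᶜ := hE₁ ▸ Finset.filter_subset _ _
  have hdisj : Disjoint E E₁ := by
    exact disjoint_compl_right.mono_right hE₁sub
  have hPc : (E ∪ E₁)ᶜ = Eᶜ \ E₁ := by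
    ext i
    simp
  have hE₁sum : (E₁.card : ℝ) * α ≤ ∑ i ∈ E₁, σ i := by
    rw [← nsmul_eq_mul]
    refine Finset.card_nsmul_le_sum _ _ _ fun i hi => ?_
    rw [hE₁, Finset.mem_filter] at hi
    exact hi.2.le
  have htail := Finset.sum_sdiff hE₁sub (f := σ)
  have hr : (E₁.card : ℝ) ≤ (t - 1) * k := by
    rcases hα0.eq_or_lt with h | h
    · have hB' : B = 0 := by rw [hBα, ← h, mul_zero]
      have hE₁' : E₁ = ∅ := by
        rw [hE₁, Finset.filter_eq_empty_iff]
        intro i hi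
        rw [← h, (Finset.sum_eq_zero_iff_of_nonneg fun i _ => hσ0 i).1 hB' i hi]
        exact lt_irrefl 0
      simp [hE₁', htk.le]
    · refine le_of_mul_le_mul_right ?_ h
      have : 0 ≤ ∑ i ∈ Eᶜ \ E₁, σ i := Finset.sum_nonneg fun i _ => hσ0 i
      linarith
  have hcard : (E ∪ E₁).card ≤ s := by
    have : ((k + E₁.card : ℕ) : ℝ) ≤ s := by
      push_cast
      linarith
    exact (Finset.card_union_of_disjoint hdisj).trans_le (hE ▸ by exact_mod_cast this)
  obtain ⟨N, hN⟩ := Nat.exists_eq_add_of_le hcard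
  have hN' : (N : ℝ) = (t - 1) * k - E₁.card := by
    rw [Finset.card_union_of_disjoint hdisj, hE] at hN
    have : (s : ℝ) = k + E₁.card + N := by exact_mod_cast hN
    linarith
  have hmain := hRIP.le_two_mul_norm_sq_add_inner (N := N) (α := α) hδ0 hu hv hN.ge
    (fun i _ => hσ0 i)
    (by
      intro i hi
      by_contra! hlt
      simp only [hE₁, Finset.mem_compl, Finset.mem_union, Finset.mem_filter, not_or, not_and]
        at hi
      exact hi.2 hi.1 hlt)
    (by
      rw [hPc, hN']
      linarith)
  rw [← hH] at hmain
  have hrank : (∑ i ∈ E ∪ E₁, rank1 (σ i) (u i) (v i)).rank ≤ s := by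
    rw [← rankOneComb_indicator u v]
    exact (rank_rankOneComb_le u v (E ∪ E₁) _ fun i hi => if_neg hi).trans hcard
  set X := ∑ i ∈ E ∪ E₁, rank1 (σ i) (u i) (v i)
  have hx := frobNorm_nonneg X
  have hAX : ‖A X‖ ≤ Real.sqrt (1 + δ) * frobNorm X := by
    refine le_of_sq_le_sq ?_ (by positivity)
    rw [mul_pow, Real.sq_sqrt (by linarith)]
    exact (hRIP X hrank).2
  have hinner : inner ℝ (A X) (A H) ≤ Real.sqrt (1 + δ) * ‖A H‖ * frobNorm X :=
    (real_inner_le_norm _ _).trans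
      ((mul_le_mul_of_nonneg_right hAX (norm_nonneg _)).trans_eq (by ring))
  have hNα : δ ^ 2 * (N * α ^ 2) ≤ δ ^ 2 / ((t - 1) * k) * B ^ 2 := by
    have : δ ^ 2 / ((t - 1) * k) * B ^ 2 = δ ^ 2 * ((t - 1) * k * α ^ 2) := by
      rw [hBα, mul_pow, sq ((t - 1) * k), ← mul_assoc, ← mul_assoc, div_mul_cancel₀ _ htk.ne',
        mul_assoc]
    rw [this, hN']
    have : (0 : ℝ) ≤ E₁.card := Nat.cast_nonneg _
    gcongr
    linarith
  have hquad : (1 - δ ^ 2) * frobNorm X ^ 2 - 2 * Real.sqrt (1 + δ) * ‖A H‖ * frobNorm X -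
      (δ ^ 2 / ((t - 1) * k)) * B ^ 2 ≤ 0 := by
    linarith
  refine ⟨hquad, ?_⟩
  have h1δ : 0 < 1 - δ := by linarith
  have hδ2 : 0 < 1 - δ ^ 2 := by nlinarith
  have ht1 : 0 < t - 1 := by linarith
  refine le_add_of_sq_le (by positivity) (by positivity) ?_
  have hr2 : (δ / Real.sqrt ((1 - δ ^ 2) * (t - 1)) * B / Real.sqrt k) ^ 2 =
      (δ ^ 2 / ((t - 1) * k)) * B ^ 2 / (1 - δ ^ 2) := by
    rw [div_pow, mul_pow, div_pow, Real.sq_sqrt (by positivity), Real.sq_sqrt hk'.le]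
    field_simp
  have hq : 2 / ((1 - δ) * Real.sqrt (1 + δ)) * ‖A H‖ =
      2 * Real.sqrt (1 + δ) * ‖A H‖ / (1 - δ ^ 2) := by
    have hs : Real.sqrt (1 + δ) ^ 2 = 1 + δ := Real.sq_sqrt (by linarith)
    have : 1 - δ ^ 2 = (1 - δ) * Real.sqrt (1 + δ) ^ 2 := by
      rw [hs]
      ring
    rw [this]
    have : 0 < Real.sqrt (1 + δ) := Real.sqrt_pos.2 (by linarith)
    field_simp
  rw [hr2, hq, div_mul_eq_mul_div, ← add_div, le_div_iff₀ hδ2]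
  linarith
end

section
/- Let A : ℝ^{n₁×n₂} → ℝ^m be a linear map satisfying the RIP of order ⌈tk⌉ with restricted isometry constant δ_{tk} satisfying δ_{tk} < √((t−1)/t) for some fixed t > 1 and positive integer k. Let X ∈ ℝ^{n₁×n₂}, n ∈ ℝ^m with ‖n‖₂ ≤ ε, b = A(X) + n, λ > 0, let X♯ be a minimizer of Z ↦ ‖Z‖_* + (1/(2λ))‖b − A(Z)‖₂², set H = X♯ − X and E = {1,…,k}. Then ‖A(H)‖₂² − 2(√k·β₁·λ + ε)‖A(H)‖₂ − 4λ‖X_{E^c}‖_* ≤ 0, where β₁ = 2/((1−δ_{tk})√(1+δ_{tk})). -/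
open Finset

lemma exists_card_le_sum_mul_le {ι : Type*} [DecidableEq ι] (s : Finset ι) (c y : ι → ℝ)
    {a : ℝ} (N : ℕ) (hy0 : ∀ i ∈ s, 0 ≤ y i) (hya : ∀ i ∈ s, y i ≤ a)
    (hsum : ∑ i ∈ s, y i ≤ N * a) :
    ∃ S ⊆ s, S.card ≤ N ∧ ∑ i ∈ s, c i * y i ≤ a * ∑ i ∈ S, c i := by
  obtain ⟨S, hS, hmax⟩ := (s.powerset.filter fun S => S.card ≤ N).exists_max_image
    (fun S => ∑ i ∈ S, c i) ⟨∅, by simp⟩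
  simp only [mem_filter, mem_powerset] at hS hmax
  obtain ⟨hSs, hSN⟩ := hS
  have hin : ∀ i ∈ S, 0 ≤ c i := fun i hi => by
    have := hmax (S.erase i) ⟨(erase_subset _ _).trans hSs, (card_erase_le).trans hSN⟩
    rw [← add_sum_erase S c hi] at this
    linarith
  have hex : ∀ i ∈ S, ∀ j ∈ s \ S, c j ≤ c i := fun i hi j hj => by
    obtain ⟨hjs, hjS⟩ := mem_sdiff.1 hj
    have hj' : j ∉ S.erase i := fun h => hjS (mem_of_mem_erase h)
    have := hmax (insert j (S.erase i))
      ⟨insert_subset hjs ((erase_subset _ _).trans hSs), by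
        rw [card_insert_of_notMem hj', card_erase_add_one hi]; exact hSN⟩
    rw [← add_sum_erase S c hi, sum_insert hj'] at this
    linarith
  have hout : S.card < N → ∀ j ∈ s \ S, c j ≤ 0 := fun hlt j hj => by
    obtain ⟨hjs, hjS⟩ := mem_sdiff.1 hj
    have := hmax (insert j S) ⟨insert_subset hjs hSs, by rw [card_insert_of_notMem hjS]; exact hlt⟩
    rw [sum_insert hjS] at this
    linarith
  obtain ⟨θ, hθ0, hθin, hθout, hθ⟩ : ∃ θ : ℝ, 0 ≤ θ ∧ (∀ i ∈ S, θ ≤ c i) ∧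
      (∀ j ∈ s \ S, c j ≤ θ) ∧ θ * (N - S.card) = 0 := by
    rcases (s \ S).eq_empty_or_nonempty with he | hne
    · exact ⟨0, le_rfl, hin, by simp [he], by simp⟩
    · obtain ⟨j, hj, hjmax⟩ := (s \ S).exists_max_image c hne
      refine ⟨max 0 (c j), le_max_left _ _, fun i hi => max_le (hin i hi) (hex i hi j hj),
        fun l hl => (hjmax l hl).trans (le_max_right _ _), ?_⟩
      rcases hSN.lt_or_eq with hlt | heq
      · rw [max_eq_left (hout hlt j hj), zero_mul]
      · rw [heq, sub_self, mul_zero]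
  refine ⟨S, hSs, hSN, ?_⟩
  have h1 : ∑ i ∈ s \ S, c i * y i ≤ θ * ∑ i ∈ s \ S, y i := by
    rw [mul_sum]
    exact sum_le_sum fun i hi =>
      mul_le_mul_of_nonneg_right (hθout i hi) (hy0 i (mem_sdiff.1 hi).1)
  have h2 : ∑ i ∈ S, (c i * y i + θ * (a - y i)) ≤ ∑ i ∈ S, a * c i :=
    sum_le_sum fun i hi => by
      nlinarith [mul_nonneg (sub_nonneg.2 (hθin i hi)) (sub_nonneg.2 (hya i (hSs hi)))]
  rw [sum_add_distrib, ← mul_sum, sum_sub_distrib, sum_const, nsmul_eq_mul, ← mul_sum] at h2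
  have h3 := sum_sdiff (f := y) hSs
  have h4 := sum_sdiff (f := fun i => c i * y i) hSs
  have h5 : θ * ∑ i ∈ s \ S, y i ≤ θ * (N * a - ∑ i ∈ S, y i) :=
    mul_le_mul_of_nonneg_left (by linarith) hθ0
  have h6 : θ * (N * a - ∑ i ∈ S, y i) = θ * (S.card * a - ∑ i ∈ S, y i) := by
    linear_combination a * hθ
  linarith

/-- Optimal cross-term bound. -/
lemma sq_cross_le {δ Q U τ s w : ℝ} (hδ : 0 < δ)
    (hup : ∀ x y : ℝ, x ^ 2 * τ + 2 * x * y * w + y ^ 2 * s ≤ δ * (x ^ 2 * Q + y ^ 2 * U))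
    (hlo : ∀ x y : ℝ, -(δ * (x ^ 2 * Q + y ^ 2 * U)) ≤ x ^ 2 * τ + 2 * x * y * w + y ^ 2 * s) :
    Q * w ^ 2 ≤ U * (δ ^ 2 * Q ^ 2 - τ ^ 2) := by
  have key : ∀ α β γ : ℝ, (∀ x y : ℝ, 0 ≤ x ^ 2 * α + 2 * x * y * β + y ^ 2 * γ) →
      0 ≤ α ∧ β ^ 2 ≤ α * γ := fun α β γ h => by
    refine ⟨by simpa using h 1 0, ?_⟩
    have := discrim_le_zero (a := α) (b := 2 * β) (c := γ) fun x => by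
      have := h x 1
      linarith
    rw [discrim] at this
    linarith
  obtain ⟨ha, h1⟩ := key (δ * Q - τ) (-w) (δ * U - s) fun x y => by linarith [hup x y]
  obtain ⟨hb, h2⟩ := key (δ * Q + τ) w (δ * U + s) fun x y => by linarith [hlo x y]
  have h3 := mul_le_mul_of_nonneg_left h1 hb
  have h4 := mul_le_mul_of_nonneg_left h2 ha
  have : 0 ≤ 2 * δ * (U * (δ ^ 2 * Q ^ 2 - τ ^ 2) - Q * w ^ 2) := by nlinarith
  have := nonneg_of_mul_nonneg_right this (by positivity)
  linarith

lemma sqrt_le_of_inner_ge {δ Q U P w g : ℝ} (hδ : 0 < δ) (hδ1 : δ < 1) (hQ : 0 < Q) (hU : 0 ≤ U)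
    (hg : 0 ≤ g) (hP : (1 - δ) * Q ≤ P)
    (hw : Q * w ^ 2 ≤ U * (δ ^ 2 * Q ^ 2 - (P - Q) ^ 2))
    (hmain : P + w ≤ √P * g) :
    √Q ≤ g / √(1 - δ) + δ / √(1 - δ ^ 2) * √U := by
  have h1 : 0 < 1 - δ := by linarith
  have h2 : 0 < 1 - δ ^ 2 := by nlinarith
  have hP0 : 0 < P := lt_of_lt_of_le (by positivity) hP
  set κ := δ / √(1 - δ ^ 2) with hκ
  have hκ0 : 0 ≤ κ := by positivity
  have hκ2 : κ ^ 2 * (1 - δ ^ 2) = δ ^ 2 := by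
    rw [hκ, div_pow, Real.sq_sqrt h2.le]; field_simp
  have h3 : δ ^ 2 * Q ^ 2 - (P - Q) ^ 2 ≤ κ ^ 2 * P ^ 2 := by
    have : 0 ≤ (1 - δ ^ 2) * (κ ^ 2 * P ^ 2 - (δ ^ 2 * Q ^ 2 - (P - Q) ^ 2)) := by
      have : (1 - δ ^ 2) * (κ ^ 2 * P ^ 2 - (δ ^ 2 * Q ^ 2 - (P - Q) ^ 2))
        = (P - (1 - δ ^ 2) * Q) ^ 2 := by linear_combination P ^ 2 * hκ2
      rw [this]; positivity
    have := nonneg_of_mul_nonneg_right this h2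
    linarith
  have h4 : (√Q * |w|) ≤ √U * (κ * P) := by
    apply (pow_le_pow_iff_left₀ (by positivity) (by positivity) two_ne_zero).1
    rw [mul_pow, mul_pow, Real.sq_sqrt hQ.le, Real.sq_sqrt hU, sq_abs, mul_pow]
    exact hw.trans (mul_le_mul_of_nonneg_left h3 hU)
  have h5 : √Q * √P ≤ √Q * g + κ * √U * √P := by
    have hsP : √P ^ 2 = P := Real.sq_sqrt hP0.le
    have : √P * (√Q * √P) ≤ √P * (√Q * g + κ * √U * √P) := by
      have a1 : √Q * (P + w) ≤ √Q * (√P * g) :=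
        mul_le_mul_of_nonneg_left hmain (Real.sqrt_nonneg _)
      have a2 : √Q * (-w) ≤ √Q * |w| :=
        mul_le_mul_of_nonneg_left (neg_le_abs w) (Real.sqrt_nonneg _)
      have a3 : √P * (√Q * √P) = √Q * P := by linear_combination √Q * hsP
      have a4 : √P * (√Q * g + κ * √U * √P) = √Q * (√P * g) + √U * (κ * P) := by
        linear_combination κ * √U * hsP
      linarith
    exact le_of_mul_le_mul_left this (Real.sqrt_pos.2 hP0)
  have h6 : √(1 - δ) * √Q ≤ √P := by
    rw [← Real.sqrt_mul h1.le]; exact Real.sqrt_le_sqrt hP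
  have hsP := Real.sqrt_pos.2 hP0
  have hs1 := Real.sqrt_pos.2 h1
  have h7 : √Q * g ≤ g / √(1 - δ) * √P := by
    rw [div_mul_eq_mul_div, le_div_iff₀ hs1]
    nlinarith
  have : √Q * √P ≤ (g / √(1 - δ) + κ * √U) * √P := by linarith
  exact le_of_mul_le_mul_right this hsP

open scoped RealInnerProductSpace in
/-- A family `e` on which sparse combinations are near-isometric: robust null space property. -/
lemma sum_sub_sum_compl_le_of_sparse_rip {ι F : Type*} [Fintype ι] [DecidableEq ι]
    [NormedAddCommGroup F] [InnerProductSpace ℝ F] (e : ι → F) {δ : ℝ} (hδ : 0 < δ) (hδ1 : δ < 1)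
    {k r : ℕ} (hr : 0 < r) (hkr : k * δ ^ 2 ≤ r * (1 - δ ^ 2))
    (hrip : ∀ (c : ι → ℝ) (T : Finset ι), T.card ≤ k + r →
      (1 - δ) * ∑ i ∈ T, c i ^ 2 ≤ ‖∑ i ∈ T, c i • e i‖ ^ 2 ∧
        ‖∑ i ∈ T, c i • e i‖ ^ 2 ≤ (1 + δ) * ∑ i ∈ T, c i ^ 2)
    (h : ι → ℝ) (hh : ∀ i, 0 ≤ h i) (S : Finset ι) (hS : S.card ≤ k) :
    ∑ i ∈ S, h i - ∑ i ∈ Sᶜ, h i ≤ √k * (‖∑ i, h i • e i‖ / √(1 - δ)) := by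
  have hr' : (0 : ℝ) < r := by exact_mod_cast hr
  set B := ∑ i ∈ Sᶜ, h i with hB
  have hB0 : 0 ≤ B := sum_nonneg fun i _ => hh i
  set a := B / r with ha
  have ha0 : 0 ≤ a := by positivity
  have hra : r * a = B := by rw [ha]; field_simp
  set big := Sᶜ.filter fun i => a < h i with hbig
  set T := S ∪ big with hT
  have hST : Disjoint S big :=
    disjoint_left.2 fun i hi hi' => mem_compl.1 (mem_filter.1 hi').1 hi
  have hBsplit : ∑ i ∈ big, h i + ∑ i ∈ Tᶜ, h i = B := by
    rw [hB, ← sum_filter_add_sum_filter_not Sᶜ (fun i => a < h i)]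
    congr 1
    refine sum_congr ?_ fun _ _ => rfl
    ext i
    simp only [hT, hbig, mem_compl, mem_union, mem_filter]
    tauto
  have hbigsum : big.card * a ≤ ∑ i ∈ big, h i := by
    rw [← nsmul_eq_mul]
    exact card_nsmul_le_sum _ _ _ fun i hi => (mem_filter.1 hi).2.le
  have hTc0 : 0 ≤ ∑ i ∈ Tᶜ, h i := sum_nonneg fun i _ => hh i
  have hbigcard : big.card ≤ r := by
    by_contra! hlt
    have hne : big.Nonempty := card_pos.1 (by omega)
    have h1 : big.card * a < ∑ i ∈ big, h i := by
      rw [← nsmul_eq_mul, ← sum_const]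
      exact sum_lt_sum_of_nonempty hne fun i hi => (mem_filter.1 hi).2
    have h2 : (r : ℝ) * a ≤ big.card * a :=
      mul_le_mul_of_nonneg_right (by exact_mod_cast hlt.le) ha0
    linarith
  have hTcard : T.card = S.card + big.card := card_union_of_disjoint hST
  set Φz := ∑ i ∈ T, h i • e i with hΦz
  set Q := ∑ i ∈ T, h i ^ 2 with hQ
  have hQ0 : 0 ≤ Q := sum_nonneg fun i _ => sq_nonneg _
  have hSsum : ∑ i ∈ S, h i ≤ √k * √Q := by
    rw [← Real.sqrt_mul (Nat.cast_nonneg k)]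
    apply Real.le_sqrt_of_sq_le
    refine sq_sum_le_card_mul_sum_sq.trans ?_
    refine mul_le_mul (by exact_mod_cast hS) ?_ (sum_nonneg fun i _ => sq_nonneg _)
      (Nat.cast_nonneg k)
    exact sum_le_sum_of_subset_of_nonneg subset_union_left fun i _ _ => sq_nonneg _
  rcases hQ0.eq_or_lt with hQz | hQpos
  · rw [← hQz, Real.sqrt_zero, mul_zero] at hSsum
    have : 0 ≤ √k * (‖∑ i, h i • e i‖ / √(1 - δ)) := by positivity
    linarith
  obtain ⟨S', hS'T, hS'card, hS'⟩ := exists_card_le_sum_mul_le Tᶜ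
    (fun i => -⟪Φz, e i⟫) h (r - big.card) (fun i _ => hh i)
    (fun i hi => by
      by_contra! hlt
      simp only [hT, hbig, mem_compl, mem_union, mem_filter] at hi
      tauto)
    (by rw [Nat.cast_sub hbigcard]; linarith)
  have hTS' : Disjoint T S' := disjoint_left.2 fun i hi hi' => mem_compl.1 (hS'T hi') hi
  set Φu := ∑ i ∈ S', a • e i with hΦu
  set U := ∑ _i ∈ S', a ^ 2 with hU
  have hU0 : 0 ≤ U := sum_nonneg fun i _ => sq_nonneg _
  have hUle : √U ≤ a * √r := by
    rw [Real.sqrt_le_left (by positivity), mul_pow, Real.sq_sqrt hr'.le, hU, sum_const,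
      nsmul_eq_mul, mul_comm]
    refine mul_le_mul_of_nonneg_left ?_ (sq_nonneg _)
    exact_mod_cast hS'card.trans (Nat.sub_le _ _)
  have hcomb : ∀ x y : ℝ, (1 - δ) * (x ^ 2 * Q + y ^ 2 * U) ≤ ‖x • Φz + y • Φu‖ ^ 2 ∧
      ‖x • Φz + y • Φu‖ ^ 2 ≤ (1 + δ) * (x ^ 2 * Q + y ^ 2 * U) := fun x y => by
    have hcard : (T ∪ S').card ≤ k + r := by
      rw [card_union_of_disjoint hTS']; omega
    have := hrip (fun i => if i ∈ T then x * h i else y * a) (T ∪ S') hcard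
    rw [sum_union hTS', sum_union hTS'] at this
    have e1 : ∑ i ∈ T, (if i ∈ T then x * h i else y * a) ^ 2 = x ^ 2 * Q := by
      rw [hQ, mul_sum]
      exact sum_congr rfl fun i hi => by rw [if_pos hi, mul_pow]
    have e2 : ∑ i ∈ S', (if i ∈ T then x * h i else y * a) ^ 2 = y ^ 2 * U := by
      rw [hU, mul_sum]
      exact sum_congr rfl fun i hi => by rw [if_neg (disjoint_right.1 hTS' hi), mul_pow]
    have e3 : ∑ i ∈ T, (if i ∈ T then x * h i else y * a) • e i = x • Φz := by
      rw [hΦz, smul_sum]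
      exact sum_congr rfl fun i hi => by rw [if_pos hi, mul_smul]
    have e4 : ∑ i ∈ S', (if i ∈ T then x * h i else y * a) • e i = y • Φu := by
      rw [hΦu, smul_sum]
      exact sum_congr rfl fun i hi => by rw [if_neg (disjoint_right.1 hTS' hi), mul_smul]
    rwa [e1, e2, e3, e4] at this
  have hexp : ∀ x y : ℝ, ‖x • Φz + y • Φu‖ ^ 2 =
      x ^ 2 * ‖Φz‖ ^ 2 + 2 * x * y * ⟪Φz, Φu⟫ + y ^ 2 * ‖Φu‖ ^ 2 := fun x y => by
    rw [norm_add_sq_real, norm_smul, norm_smul, mul_pow, mul_pow, Real.norm_eq_abs,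
      Real.norm_eq_abs, sq_abs, sq_abs, real_inner_smul_left, real_inner_smul_right]
    ring
  have hcross : Q * ⟪Φz, Φu⟫ ^ 2 ≤ U * (δ ^ 2 * Q ^ 2 - (‖Φz‖ ^ 2 - Q) ^ 2) :=
    sq_cross_le (s := ‖Φu‖ ^ 2 - U) hδ
      (fun x y => by have := (hcomb x y).2; rw [hexp] at this; linarith)
      (fun x y => by have := (hcomb x y).1; rw [hexp] at this; linarith)
  have hmain : ‖Φz‖ ^ 2 + ⟪Φz, Φu⟫ ≤ √(‖Φz‖ ^ 2) * ‖∑ i, h i • e i‖ := by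
    rw [Real.sqrt_sq (norm_nonneg _)]
    refine le_trans ?_ (real_inner_le_norm _ _)
    rw [← sum_add_sum_compl T, inner_add_right, ← hΦz, real_inner_self_eq_norm_sq, hΦu,
      inner_sum, inner_sum]
    simp only [real_inner_smul_right]
    simp only [neg_mul, sum_neg_distrib, mul_neg, mul_sum, neg_le_neg_iff] at hS'
    simp only [mul_comm (h _)]
    linarith
  have hP : (1 - δ) * Q ≤ ‖Φz‖ ^ 2 := by simpa using (hcomb 1 0).1
  have hfin := sqrt_le_of_inner_ge hδ hδ1 hQpos hU0 (norm_nonneg _) hP hcross hmain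
  have h2 : 0 < 1 - δ ^ 2 := by nlinarith
  have hκ : √k * (δ / √(1 - δ ^ 2) * √U) ≤ B := by
    have h3 : √k * δ ≤ √r * √(1 - δ ^ 2) := by
      rw [← Real.sqrt_mul hr'.le]
      apply Real.le_sqrt_of_sq_le
      rw [mul_pow, Real.sq_sqrt (Nat.cast_nonneg k)]
      exact hkr
    have h4 : √k * (δ / √(1 - δ ^ 2)) ≤ √r := by
      rw [← mul_div_assoc, div_le_iff₀ (Real.sqrt_pos.2 h2)]
      exact h3
    calc √k * (δ / √(1 - δ ^ 2) * √U) = √k * (δ / √(1 - δ ^ 2)) * √U := by ring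
      _ ≤ √r * (a * √r) := mul_le_mul h4 hUle (Real.sqrt_nonneg _) (Real.sqrt_nonneg _)
      _ = r * a := by linear_combination a * Real.mul_self_sqrt hr'.le
      _ = B := hra
  have := mul_le_mul_of_nonneg_left hfin (Real.sqrt_nonneg k)
  rw [mul_add] at this
  linarith

section Isometries

open scoped RealInnerProductSpace

variable {V W : Type*} [NormedAddCommGroup V] [InnerProductSpace ℝ V]
  [NormedAddCommGroup W] [InnerProductSpace ℝ W]

/-- Composing with a hyperplane reflection lowers the trace pairing of two orthonormal families
by at most two. -/
lemma sum_inner_sub_two_le_sum_inner_reflection {ι : Type*} [Fintype ι] (w : W) {q g : ι → W}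
    (hq : Orthonormal ℝ q) (hg : Orthonormal ℝ g) :
    ∑ i, ⟪q i, g i⟫ - 2 ≤ ∑ i, ⟪q i, (Submodule.span ℝ {w})ᗮ.reflection (g i)⟫ := by
  have hr : ∀ i, ⟪q i, (Submodule.span ℝ {w})ᗮ.reflection (g i)⟫ =
      ⟪q i, g i⟫ - 2 * (⟪w, g i⟫ / ‖w‖ ^ 2 * ⟪q i, w⟫) := fun i => by
    rw [Submodule.reflection_orthogonal_apply, Submodule.reflection_singleton_apply,
      neg_sub, inner_sub_right, two_smul, inner_add_right, real_inner_smul_right]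
    simp only [RCLike.ofReal_real_eq_id, id]
    ring
  simp only [hr, sum_sub_distrib, ← mul_sum]
  have h1 := hq.sum_inner_products_le (s := univ) (x := w)
  have h2 := hg.sum_inner_products_le (s := univ) (x := w)
  simp only [Real.norm_eq_abs, sq_abs] at h1 h2
  have h3 : ∑ i, ⟪w, g i⟫ / ‖w‖ ^ 2 * ⟪q i, w⟫ ≤ 1 := by
    rcases eq_or_ne w 0 with rfl | hw
    · simp
    have hw2 : 0 < ‖w‖ ^ 2 := by positivity
    have : ∑ i, ⟪w, g i⟫ / ‖w‖ ^ 2 * ⟪q i, w⟫ = (∑ i, ⟪g i, w⟫ * ⟪q i, w⟫) / ‖w‖ ^ 2 := by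
      rw [sum_div]
      exact sum_congr rfl fun i _ => by rw [real_inner_comm w (g i)]; ring
    rw [this, div_le_one hw2]
    have h4 : ∑ i, ⟪g i, w⟫ * ⟪q i, w⟫ ≤ ∑ i, (⟪g i, w⟫ ^ 2 + ⟪q i, w⟫ ^ 2) / 2 :=
      sum_le_sum fun i _ => by nlinarith [sq_nonneg (⟪g i, w⟫ - ⟪q i, w⟫)]
    rw [← sum_div, sum_add_distrib] at h4
    linarith
  linarith

/-- An isometry can be corrected, at trace cost two per vector, so that it maps one orthonormal
family to another. -/
lemma exists_linearIsometry_map_eq {ι κ : Type*} [Fintype ι] [DecidableEq κ]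
    {p : ι → V} {q : ι → W} (hp : Orthonormal ℝ p) (hq : Orthonormal ℝ q) (L₀ : V →ₗᵢ[ℝ] W)
    (hL₀ : ∀ i, L₀ (p i) = q i) {u : κ → V} {v : κ → W} (hu : Orthonormal ℝ u)
    (hv : Orthonormal ℝ v) (E : Finset κ) :
    ∃ L : V →ₗᵢ[ℝ] W, (∀ j ∈ E, L (u j) = v j) ∧
      (Fintype.card ι : ℝ) - 2 * E.card ≤ ∑ i, ⟪q i, L (p i)⟫ := by
  induction E using Finset.induction_on with
  | empty =>
    refine ⟨L₀, by simp, ?_⟩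
    simp [hL₀, hq.norm_eq_one]
  | insert a E ha ih =>
    obtain ⟨L, hL, htr⟩ := ih
    set R := (Submodule.span ℝ {L (u a) - v a})ᗮ.reflection
    refine ⟨R.toLinearIsometry.comp L, fun j hj => ?_, ?_⟩
    · rcases mem_insert.1 hj with rfl | hj
      · exact Submodule.reflection_sub (by rw [L.norm_map, hu.norm_eq_one, hv.norm_eq_one])
      · have hja : j ≠ a := fun h => ha (h ▸ hj)
        change R (L (u j)) = v j
        rw [hL j hj]
        apply Submodule.reflection_mem_subspace_eq_self
        rw [Submodule.mem_orthogonal_singleton_iff_inner_right, inner_sub_left, ← hL j hj,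
          L.inner_map_map, hu.inner_eq_zero hja.symm, hL j hj, hv.inner_eq_zero hja.symm, sub_zero]
    · have := sum_inner_sub_two_le_sum_inner_reflection (L (u a) - v a) hq
        (hp.comp_linearIsometry L)
      rw [card_insert_of_notMem ha]
      push_cast
      simp only [Function.comp_apply] at this
      refine le_trans ?_ this
      linarith

lemma sum_inner_map_orthonormalBasis_eq {ι : Type*} [Fintype ι] [FiniteDimensional ℝ V]
    [FiniteDimensional ℝ W] (b c : OrthonormalBasis ι ℝ V) (L T : V →ₗ[ℝ] W) :
    ∑ i, ⟪L (b i), T (b i)⟫ = ∑ i, ⟪L (c i), T (c i)⟫ := by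
  have key : ∀ d : OrthonormalBasis ι ℝ V,
      ∑ i, ⟪L (d i), T (d i)⟫ = LinearMap.trace ℝ V (L.adjoint ∘ₗ T) := fun d => by
    rw [LinearMap.trace_eq_sum_inner _ d]
    exact sum_congr rfl fun i _ => by rw [LinearMap.comp_apply, LinearMap.adjoint_inner_right]
  rw [key b, key c]

lemma OrthonormalBasis.exists_linearIsometry_apply_eq {ι : Type*} [Fintype ι]
    (p : OrthonormalBasis ι ℝ V) {q : ι → W} (hq : Orthonormal ℝ q) :
    ∃ L : V →ₗᵢ[ℝ] W, ∀ i, L (p i) = q i := by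
  have hf : ∀ i, p.toBasis.constr ℝ q (p i) = q i := fun i => by
    rw [← p.coe_toBasis, Module.Basis.constr_basis]
  refine ⟨(p.toBasis.constr ℝ q).isometryOfOrthonormal (v := p.toBasis)
    (by rw [p.coe_toBasis]; exact p.orthonormal) ?_, hf⟩
  convert hq using 1
  ext1 i
  simp only [Function.comp_apply, p.coe_toBasis, hf]

lemma Orthonormal.exists_orthonormalBasis_coe_eq {ι : Type*} [Fintype ι] [FiniteDimensional ℝ V]
    {u : ι → V} (hu : Orthonormal ℝ u) (hcard : Module.finrank ℝ V = Fintype.card ι) :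
    ∃ b : OrthonormalBasis ι ℝ V, ⇑b = u := by
  obtain ⟨b, hb⟩ := Orthonormal.exists_orthonormalBasis_extension_of_card_eq (v := u)
    (s := Set.univ) hcard (hu.comp _ Subtype.val_injective)
  exact ⟨b, funext fun i => hb i trivial⟩

end Isometries

section Nuclear

open scoped RealInnerProductSpace

variable {n₁ n₂ : ℕ}

/-- The linear map given by the transpose of a real matrix. -/
noncomputable def transLin (M : Matrix (Fin n₁) (Fin n₂) ℝ) :
    EuclideanSpace ℝ (Fin n₁) →ₗ[ℝ] EuclideanSpace ℝ (Fin n₂) :=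
  M.conjTranspose.toEuclideanLin

lemma transLin_injective :
    Function.Injective (transLin : Matrix (Fin n₁) (Fin n₂) ℝ → _) := fun _ _ h =>
  Matrix.conjTranspose_injective (Matrix.toEuclideanLin.injective h)

lemma transLin_sub (M N : Matrix (Fin n₁) (Fin n₂) ℝ) :
    transLin (M - N) = transLin M - transLin N := by
  simp [transLin]

lemma transLin_sum {ι : Type*} (s : Finset ι) (M : ι → Matrix (Fin n₁) (Fin n₂) ℝ) :
    transLin (∑ i ∈ s, M i) = ∑ i ∈ s, transLin (M i) := by
  rw [transLin, Matrix.conjTranspose_sum, map_sum]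
  rfl

lemma transLin_rank1_apply (s : ℝ) (u : Fin n₁ → ℝ) (v : Fin n₂ → ℝ)
    (x : EuclideanSpace ℝ (Fin n₁)) :
    transLin (rank1 s u v) x = (s * ⟪WithLp.toLp 2 u, x⟫) • WithLp.toLp 2 v := by
  ext b
  simp only [transLin, rank1, Matrix.toLpLin_apply, Matrix.mulVec, dotProduct,
    Matrix.conjTranspose_apply, Matrix.of_apply, star_trivial, PiLp.smul_apply, smul_eq_mul,
    PiLp.inner_apply, mul_sum, sum_mul]
  refine sum_congr rfl fun a _ => ?_
  simp
  ring

lemma inner_transLin_transLin (M : Matrix (Fin n₁) (Fin n₂) ℝ)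
    (x y : EuclideanSpace ℝ (Fin n₁)) :
    ⟪transLin M x, transLin M y⟫ = ⟪x, (M * M.conjTranspose).toEuclideanLin y⟫ := by
  rw [transLin, Matrix.toEuclideanLin_conjTranspose_eq_adjoint, LinearMap.adjoint_inner_left,
    ← Matrix.toEuclideanLin_conjTranspose_eq_adjoint]
  simp [Matrix.toLpLin_apply, Matrix.mulVec_mulVec]

lemma orthonormal_toLp {ι : Type*} [DecidableEq ι] {n : ℕ} {u : ι → Fin n → ℝ}
    (hu : ∀ i j, ∑ a, u i a * u j a = if i = j then (1 : ℝ) else 0) :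
    Orthonormal ℝ fun i => (WithLp.toLp 2 (u i) : EuclideanSpace ℝ (Fin n)) := by
  rw [orthonormal_iff_ite]
  intro i j
  rw [← hu i j, PiLp.inner_apply]
  exact sum_congr rfl fun a _ => by simp [mul_comm]

/-- Singular value decomposition, with the singular values summing to the nuclear norm. -/
lemma exists_svd (hn : n₁ ≤ n₂) (M : Matrix (Fin n₁) (Fin n₂) ℝ) :
    ∃ (p : OrthonormalBasis (Fin n₁) ℝ (EuclideanSpace ℝ (Fin n₁)))
      (q : Fin n₁ → EuclideanSpace ℝ (Fin n₂)) (s : Fin n₁ → ℝ), Orthonormal ℝ q ∧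
      (∀ i, 0 ≤ s i) ∧ (∀ i, transLin M (p i) = s i • q i) ∧ nucNorm M = ∑ i, s i := by
  set hM := Matrix.isHermitian_mul_conjTranspose_self M
  set p := hM.eigenvectorBasis
  set g : Fin n₁ → EuclideanSpace ℝ (Fin n₂) := fun i => transLin M (p i)
  have hgg : ∀ i j, ⟪g i, g j⟫ = hM.eigenvalues j * if i = j then 1 else 0 := fun i j => by
    have : (M * M.conjTranspose).toEuclideanLin (p j) = hM.eigenvalues j • p j := by
      rw [Matrix.toLpLin_apply, hM.mulVec_eigenvectorBasis]
      rfl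
    rw [inner_transLin_transLin, this, real_inner_smul_right,
      orthonormal_iff_ite.1 p.orthonormal i j]
  have hgnorm : ∀ i, ‖g i‖ = √(hM.eigenvalues i) := fun i => by
    rw [norm_eq_sqrt_real_inner, hgg]; simp
  have hgdef : ∀ i, transLin M (p i) = g i := fun _ => rfl
  clear_value g
  set v : Fin n₂ → EuclideanSpace ℝ (Fin n₂) := fun j =>
    if h : (j : ℕ) < n₁ then ‖g ⟨j, h⟩‖⁻¹ • g ⟨j, h⟩ else 0
  have hv : Orthonormal ℝ (Set.domRestrict
      {j : Fin n₂ | ∃ h : (j : ℕ) < n₁, g ⟨j, h⟩ ≠ 0} v) := by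
    constructor
    · rintro ⟨j, h, hj⟩
      simp only [Set.domRestrict_apply, v, dif_pos h]
      rw [norm_smul, norm_inv, norm_norm, inv_mul_cancel₀ (norm_ne_zero_iff.2 hj)]
    · rintro ⟨i, hi, hi0⟩ ⟨j, hj, hj0⟩ hij
      have hne : (⟨i, hi⟩ : Fin n₁) ≠ ⟨j, hj⟩ := fun h => hij (by
        simpa [Fin.ext_iff] using h)
      simp only [Set.domRestrict_apply, v, dif_pos hi, dif_pos hj]
      rw [real_inner_smul_left, real_inner_smul_right, hgg, if_neg hne]
      simp
  obtain ⟨b, hb⟩ := Orthonormal.exists_orthonormalBasis_extension_of_card_eq (by simp) hv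
  refine ⟨p, fun i => b (Fin.castLE hn i), fun i => √(hM.eigenvalues i),
    b.orthonormal.comp _ (Fin.castLE_injective hn), fun i => Real.sqrt_nonneg _,
    fun i => ?_, rfl⟩
  beta_reduce
  rw [hgdef, ← hgnorm]
  rcases eq_or_ne (g i) 0 with h0 | h0
  · rw [h0, norm_zero, zero_smul]
  · have hmem : Fin.castLE hn i ∈ {j : Fin n₂ | ∃ h : (j : ℕ) < n₁, g ⟨j, h⟩ ≠ 0} := by
      rw [Set.mem_ofPred_eq]
      exact ⟨i.2, h0⟩
    have hvi : v (Fin.castLE hn i) = ‖g i‖⁻¹ • g i := by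
      simp only [v]
      exact dif_pos i.2
    rw [hb _ hmem, hvi, smul_inv_smul₀ (norm_ne_zero_iff.2 h0)]

lemma sum_inner_le_nucNorm (hn : n₁ ≤ n₂) (M : Matrix (Fin n₁) (Fin n₂) ℝ)
    (b : OrthonormalBasis (Fin n₁) ℝ (EuclideanSpace ℝ (Fin n₁)))
    (L : EuclideanSpace ℝ (Fin n₁) →ₗᵢ[ℝ] EuclideanSpace ℝ (Fin n₂)) :
    ∑ i, ⟪L (b i), transLin M (b i)⟫ ≤ nucNorm M := by
  obtain ⟨p, q, s, hq, hs, hpq, hnuc⟩ := exists_svd hn M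
  rw [hnuc, ← L.coe_toLinearMap, sum_inner_map_orthonormalBasis_eq b p]
  refine sum_le_sum fun i _ => ?_
  rw [hpq, real_inner_smul_right]
  refine mul_le_of_le_one_right (hs i) ((real_inner_le_norm _ _).trans ?_)
  simp [hq.norm_eq_one]

lemma nucNorm_le_sum (hn : n₁ ≤ n₂) {M : Matrix (Fin n₁) (Fin n₂) ℝ}
    (b : OrthonormalBasis (Fin n₁) ℝ (EuclideanSpace ℝ (Fin n₁)))
    {v : Fin n₁ → EuclideanSpace ℝ (Fin n₂)} (hv : Orthonormal ℝ v) {σ : Fin n₁ → ℝ}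
    (hσ : ∀ i, 0 ≤ σ i) (hM : ∀ i, transLin M (b i) = σ i • v i) :
    nucNorm M ≤ ∑ i, σ i := by
  obtain ⟨p, q, s, hq, hs, hpq, hnuc⟩ := exists_svd hn M
  obtain ⟨L, hL⟩ := p.exists_linearIsometry_apply_eq hq
  have : ∑ i, s i = ∑ i, ⟪L (p i), transLin M (p i)⟫ := sum_congr rfl fun i _ => by
    rw [hpq, hL, real_inner_smul_right, real_inner_self_eq_norm_sq, hq.norm_eq_one]
    ring
  rw [hnuc, this, ← L.coe_toLinearMap, sum_inner_map_orthonormalBasis_eq p b]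
  refine sum_le_sum fun i _ => ?_
  rw [hM, real_inner_smul_right]
  refine mul_le_of_le_one_right (hσ i) ((real_inner_le_norm _ _).trans ?_)
  simp [hv.norm_eq_one]

/-- Nuclear norm perturbation inequality relative to the best rank-`|E|` part of `N - M`. -/
lemma exists_svd_sub_nucNorm_sub_le (hn : n₁ ≤ n₂) {M : Matrix (Fin n₁) (Fin n₂) ℝ}
    (b : OrthonormalBasis (Fin n₁) ℝ (EuclideanSpace ℝ (Fin n₁)))
    {v : Fin n₁ → EuclideanSpace ℝ (Fin n₂)} (hv : Orthonormal ℝ v) {σ : Fin n₁ → ℝ}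
    (hσ : ∀ i, 0 ≤ σ i) (hM : ∀ i, transLin M (b i) = σ i • v i) (E : Finset (Fin n₁))
    (N : Matrix (Fin n₁) (Fin n₂) ℝ) :
    ∃ (p : OrthonormalBasis (Fin n₁) ℝ (EuclideanSpace ℝ (Fin n₁)))
      (q : Fin n₁ → EuclideanSpace ℝ (Fin n₂)) (h : Fin n₁ → ℝ) (S : Finset (Fin n₁)),
      Orthonormal ℝ q ∧ (∀ i, 0 ≤ h i) ∧ (∀ i, transLin (N - M) (p i) = h i • q i) ∧
      S.card ≤ E.card ∧
      nucNorm M - nucNorm N ≤ 2 * ∑ i ∈ Eᶜ, σ i + (∑ i ∈ S, h i - ∑ i ∈ Sᶜ, h i) := by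
  obtain ⟨p, q, h, hq, hh, hpq, -⟩ := exists_svd hn (N - M)
  obtain ⟨L₀, hL₀⟩ := p.exists_linearIsometry_apply_eq hq
  obtain ⟨L, hL, htr⟩ := exists_linearIsometry_map_eq p.orthonormal hq L₀ hL₀ b.orthonormal hv E
  have hle : ∀ i, |⟪q i, L (p i)⟫| ≤ 1 := fun i =>
    (abs_real_inner_le_norm _ _).trans (by simp [hq.norm_eq_one])
  obtain ⟨S, -, hScard, hS⟩ := exists_card_le_sum_mul_le univ h
    (fun i => 1 - ⟪q i, L (p i)⟫) (a := 2) E.card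
    (fun i _ => by linarith [(abs_le.1 (hle i)).2])
    (fun i _ => by linarith [(abs_le.1 (hle i)).1])
    (by
      rw [sum_sub_distrib, sum_const, card_univ, nsmul_eq_mul, mul_one]
      linarith)
  refine ⟨p, q, h, S, hq, hh, hpq, hScard, ?_⟩
  have hMle := nucNorm_le_sum hn b hv hσ hM
  have hNge := sum_inner_le_nucNorm hn N b L
  have hsplit : ∑ i, ⟪L (b i), transLin N (b i)⟫ =
      ∑ i, ⟪L (b i), transLin (N - M) (b i)⟫ + ∑ i, ⟪L (b i), transLin M (b i)⟫ := by
    rw [← sum_add_distrib]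
    exact sum_congr rfl fun i _ => by
      rw [transLin_sub, LinearMap.sub_apply, inner_sub_right, sub_add_cancel]
  have h1 : ∑ i, ⟪L (b i), transLin (N - M) (b i)⟫ = ∑ i, h i * ⟪q i, L (p i)⟫ := by
    rw [← L.coe_toLinearMap, sum_inner_map_orthonormalBasis_eq b p]
    exact sum_congr rfl fun i _ => by
      rw [hpq, real_inner_smul_right, L.coe_toLinearMap, real_inner_comm]
  have h2 : ∑ i ∈ E, σ i - ∑ i ∈ Eᶜ, σ i ≤ ∑ i, ⟪L (b i), transLin M (b i)⟫ := by
    rw [← sum_add_sum_compl E fun i => ⟪L (b i), transLin M (b i)⟫, sub_eq_add_neg,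
      ← sum_neg_distrib]
    refine add_le_add (sum_le_sum fun i hi => ?_) (sum_le_sum fun i _ => ?_)
    · rw [hM, hL i hi, real_inner_smul_right, real_inner_self_eq_norm_sq, hv.norm_eq_one]
      simp
    · rw [hM, real_inner_smul_right]
      have : |⟪L (b i), v i⟫| ≤ 1 :=
        (abs_real_inner_le_norm _ _).trans (by simp [hv.norm_eq_one])
      nlinarith [(abs_le.1 this).1, hσ i]
  have h3 := sum_add_sum_compl E σ
  have h4 := sum_add_sum_compl S h
  simp only [mul_sub, mul_one, sum_sub_distrib] at hS
  linarith

lemma eq_sum_rank1 {M : Matrix (Fin n₁) (Fin n₂) ℝ}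
    (p : OrthonormalBasis (Fin n₁) ℝ (EuclideanSpace ℝ (Fin n₁)))
    {q : Fin n₁ → EuclideanSpace ℝ (Fin n₂)} {h : Fin n₁ → ℝ}
    (hM : ∀ i, transLin M (p i) = h i • q i) :
    M = ∑ i, h i • rank1 1 (p i) (q i) := by
  apply transLin_injective
  refine p.toBasis.ext fun j => ?_
  have hr : ∀ i, transLin (h i • rank1 1 (p i) (q i)) = transLin (rank1 (h i) (p i) (q i)) :=
    fun i => congrArg _ (by ext a b; simp [rank1, mul_assoc])
  rw [p.coe_toBasis, hM, transLin_sum]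
  simp [hr, transLin_rank1_apply, orthonormal_iff_ite.1 p.orthonormal]

lemma frobNorm_sq_sum_smul_rank1 {ι : Type*} [DecidableEq ι]
    {p : ι → EuclideanSpace ℝ (Fin n₁)} (hp : Orthonormal ℝ p)
    {q : ι → EuclideanSpace ℝ (Fin n₂)} (hq : Orthonormal ℝ q) (c : ι → ℝ) (T : Finset ι) :
    frobNorm (∑ i ∈ T, c i • rank1 1 (p i) (q i)) ^ 2 = ∑ i ∈ T, c i ^ 2 := by
  have hin : ∀ {n : ℕ} (x y : EuclideanSpace ℝ (Fin n)), ∑ a, x a * y a = ⟪x, y⟫ := fun x y => by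
    rw [PiLp.inner_apply]
    exact sum_congr rfl fun a _ => by simp [mul_comm]
  have hp' := orthonormal_iff_ite.1 hp
  have hq' := orthonormal_iff_ite.1 hq
  have hfrob : ∀ M : Matrix (Fin n₁) (Fin n₂) ℝ, frobNorm M ^ 2 = ∑ a, ∑ b, M a b ^ 2 :=
    fun M => Real.sq_sqrt (sum_nonneg fun _ _ => sum_nonneg fun _ _ => sq_nonneg _)
  rw [hfrob]
  have h1 : ∀ a b, (∑ i ∈ T, c i • rank1 1 (p i) (q i)) a b ^ 2 =
      ∑ i ∈ T, ∑ j ∈ T, c i * c j * ((p i a * p j a) * (q i b * q j b)) := fun a b => by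
    rw [Matrix.sum_apply, sq, sum_mul_sum]
    refine sum_congr rfl fun i _ => sum_congr rfl fun j _ => ?_
    simp only [rank1, Matrix.smul_apply, Matrix.of_apply, smul_eq_mul]
    ring
  have h2 : ∀ i j, ∑ a, ∑ b, c i * c j * ((p i a * p j a) * (q i b * q j b)) =
      if i = j then c i * c j else 0 := fun i j => by
    simp only [← mul_sum]
    rw [← sum_mul, hin, hin, hp', hq']
    split_ifs <;> simp
  calc ∑ a, ∑ b, (∑ i ∈ T, c i • rank1 1 (p i) (q i)) a b ^ 2
      = ∑ i ∈ T, ∑ j ∈ T, ∑ a, ∑ b, c i * c j * ((p i a * p j a) * (q i b * q j b)) := by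
        simp only [h1]
        simp only [sum_comm (s := (univ : Finset (Fin n₂))) (t := T)]
        simp only [sum_comm (s := (univ : Finset (Fin n₁))) (t := T)]
    _ = ∑ i ∈ T, c i ^ 2 := by
        simp only [h2]
        refine sum_congr rfl fun i hi => ?_
        rw [sum_ite_eq, if_pos hi, sq]

lemma rank_sum_smul_rank1_le {ι : Type*} (p : ι → Fin n₁ → ℝ) (q : ι → Fin n₂ → ℝ) (c : ι → ℝ)
    (T : Finset ι) : (∑ i ∈ T, c i • rank1 1 (p i) (q i)).rank ≤ T.card := by
  have : ∑ i ∈ T, c i • rank1 1 (p i) (q i) =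
      (Matrix.of fun a (i : T) => c i * p i a) * (Matrix.of fun (i : T) b => q i b) := by
    ext a b
    rw [Matrix.sum_apply, Matrix.mul_apply, ← sum_coe_sort]
    exact sum_congr rfl fun i _ => by simp [rank1, mul_assoc]
  rw [this]
  refine (Matrix.rank_mul_le_left _ _).trans ((Matrix.rank_le_card_width _).trans ?_)
  simp

end Nuclear

theorem stmt11 {n₁ n₂ m k : ℕ} (hk : 0 < k) (hn : n₁ ≤ n₂)
    (A : Matrix (Fin n₁) (Fin n₂) ℝ →ₗ[ℝ] EuclideanSpace ℝ (Fin m))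
    (t δ : ℝ) (ht : 1 < t) (hδ0 : 0 < δ)
    (hδ : δ < Real.sqrt ((t - 1) / t))
    (hRIP : HasRIP A ⌈t * (k : ℝ)⌉₊ δ)
    (X : Matrix (Fin n₁) (Fin n₂) ℝ)
    -- SVD of `X`, with singular values `σ` in decreasing order
    (σ : Fin n₁ → ℝ) (u : Fin n₁ → Fin n₁ → ℝ) (v : Fin n₁ → Fin n₂ → ℝ)
    (hσ0 : ∀ i, 0 ≤ σ i) (hσmono : ∀ i j : Fin n₁, i ≤ j → σ j ≤ σ i)
    (hu : ∀ i j, ∑ a, u i a * u j a = if i = j then (1 : ℝ) else 0)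
    (hv : ∀ i j, ∑ b, v i b * v j b = if i = j then (1 : ℝ) else 0)
    (hX : X = ∑ i, rank1 (σ i) (u i) (v i))
    (nv : EuclideanSpace ℝ (Fin m)) (ε : ℝ) (hnv : ‖nv‖ ≤ ε)
    (b : EuclideanSpace ℝ (Fin m)) (hb : b = A X + nv)
    (lam : ℝ) (hlam : 0 < lam)
    (Xs : Matrix (Fin n₁) (Fin n₂) ℝ)
    (hXs : ∀ Z : Matrix (Fin n₁) (Fin n₂) ℝ,
      nucNorm Xs + (1 / (2 * lam)) * ‖b - A Xs‖ ^ 2 ≤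
        nucNorm Z + (1 / (2 * lam)) * ‖b - A Z‖ ^ 2)
    -- `E = {1, …, k}`
    (E : Finset (Fin n₁)) (hEdef : E = univ.filter fun i : Fin n₁ => (i : ℕ) < k)
    (β₁ : ℝ) (hβ₁ : β₁ = 2 / ((1 - δ) * Real.sqrt (1 + δ))) :
    ‖A (Xs - X)‖ ^ 2 - 2 * (Real.sqrt k * β₁ * lam + ε) * ‖A (Xs - X)‖ -
      4 * lam * (∑ i ∈ Eᶜ, σ i) ≤ 0 := by
  obtain ⟨r, hr⟩ : ∃ r : ℕ, ⌈t * (k : ℝ)⌉₊ = k + r :=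
    Nat.exists_eq_add_of_le (by
      have : (k : ℝ) ≤ ⌈t * (k : ℝ)⌉₊ :=
        le_trans (le_mul_of_one_le_left (Nat.cast_nonneg k) ht.le) (Nat.le_ceil _)
      exact_mod_cast this)
  have hk' : (0 : ℝ) < k := by exact_mod_cast hk
  have hrt : (t - 1) * k ≤ r := by
    have := Nat.le_ceil (t * (k : ℝ))
    rw [hr] at this
    push_cast at this
    linarith
  have hr0 : 0 < r := by
    have : (0 : ℝ) < r := lt_of_lt_of_le (mul_pos (by linarith) hk') hrt
    exact_mod_cast this
  have ht0 : 0 < t := by linarith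
  have hδt : δ ^ 2 * t < t - 1 := by
    have := (Real.lt_sqrt hδ0.le).1 hδ
    rwa [lt_div_iff₀ ht0] at this
  have hδ1 : δ < 1 := by
    by_contra! h
    nlinarith [mul_le_mul h h zero_le_one hδ0.le]
  have hδsq : 0 < 1 - δ ^ 2 := by nlinarith
  have hkr : k * δ ^ 2 ≤ r * (1 - δ ^ 2) := by
    have h1 : δ ^ 2 ≤ (t - 1) * (1 - δ ^ 2) := by linarith
    calc k * δ ^ 2 ≤ k * ((t - 1) * (1 - δ ^ 2)) := mul_le_mul_of_nonneg_left h1 hk'.le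
      _ = (t - 1) * k * (1 - δ ^ 2) := by ring
      _ ≤ r * (1 - δ ^ 2) := mul_le_mul_of_nonneg_right hrt hδsq.le
  have hu' := orthonormal_toLp hu
  have hv' := orthonormal_toLp hv
  obtain ⟨ub, hub⟩ := hu'.exists_orthonormalBasis_coe_eq (by simp)
  have hXub : ∀ i, transLin X (ub i) = σ i • WithLp.toLp 2 (v i) := fun i => by
    rw [hX, transLin_sum, hub]
    simp [transLin_rank1_apply, orthonormal_iff_ite.1 hu']
  obtain ⟨p, q, h, S, hq, hh, hpq, hScard, hnuc⟩ :=
    exists_svd_sub_nucNorm_sub_le hn ub hv' hσ0 hXub E Xs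
  have hEcard : E.card ≤ k := by
    rw [hEdef, ← card_map Fin.valEmbedding]
    refine (card_le_card (t := range k) fun a ha => ?_).trans (card_range k).le
    simp only [mem_map, mem_filter] at ha
    obtain ⟨i, hi, rfl⟩ := ha
    exact mem_range.2 hi.2
  have hsum : ∀ (c : Fin n₁ → ℝ) (T : Finset (Fin n₁)),
      ∑ i ∈ T, c i • A (rank1 1 (p i) (q i)) = A (∑ i ∈ T, c i • rank1 1 (p i) (q i)) :=
    fun c T => by simp
  have hgap := sum_sub_sum_compl_le_of_sparse_rip (fun i => A (rank1 1 (p i) (q i))) hδ0 hδ1 hr0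
    hkr (fun c T hT => by
      rw [hsum, ← frobNorm_sq_sum_smul_rank1 p.orthonormal hq c T]
      refine hRIP _ ((rank_sum_smul_rank1_le _ _ c T).trans ?_)
      rwa [hr]) h hh S (hScard.trans hEcard)
  rw [hsum, ← eq_sum_rank1 p hpq] at hgap
  set g := ‖A (Xs - X)‖ with hg
  have hg0 : 0 ≤ g := norm_nonneg _
  have hβ : g / √(1 - δ) ≤ β₁ * g := by
    have h1 : 0 < 1 - δ := by linarith
    have h2 : 0 < 1 + δ := by linarith
    have h3 : 1 / √(1 - δ) ≤ β₁ := by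
      rw [hβ₁, div_le_div_iff₀ (Real.sqrt_pos.2 h1) (mul_pos h1 (Real.sqrt_pos.2 h2)), one_mul]
      have h4 : √(1 - δ) ≤ 1 := Real.sqrt_le_one.2 (by linarith)
      have h5 : √(1 + δ) ≤ 2 := Real.sqrt_le_iff.2 ⟨by norm_num, by linarith⟩
      have h6 := Real.mul_self_sqrt h1.le
      have h7 : √(1 - δ) * √(1 + δ) ≤ 2 := by
        nlinarith [Real.sqrt_nonneg (1 - δ), Real.sqrt_nonneg (1 + δ)]
      calc (1 - δ) * √(1 + δ) = √(1 - δ) * (√(1 - δ) * √(1 + δ)) := by rw [← mul_assoc, h6]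
        _ ≤ √(1 - δ) * 2 := mul_le_mul_of_nonneg_left h7 (Real.sqrt_nonneg _)
        _ = 2 * √(1 - δ) := mul_comm _ _
    calc g / √(1 - δ) = 1 / √(1 - δ) * g := by ring
      _ ≤ β₁ * g := mul_le_mul_of_nonneg_right h3 hg0
  have hβk := mul_le_mul_of_nonneg_left hβ (Real.sqrt_nonneg (k : ℝ))
  have hmin := hXs X
  have hb1 : b - A Xs = nv - A (Xs - X) := by rw [hb, map_sub]; abel
  have hb2 : b - A X = nv := by rw [hb]; abel
  rw [hb1, hb2, norm_sub_sq_real, ← hg] at hmin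
  have hcs : inner ℝ nv (A (Xs - X)) ≤ ε * g :=
    (real_inner_le_norm _ _).trans (mul_le_mul_of_nonneg_right hnv hg0)
  have hmin' : g ^ 2 - 2 * inner ℝ nv (A (Xs - X)) ≤ 2 * lam * (nucNorm X - nucNorm Xs) := by
    have h1 : 2 * lam * (1 / (2 * lam)) = 1 := by field_simp
    have := mul_le_mul_of_nonneg_left hmin (by positivity : 0 ≤ 2 * lam)
    linear_combination this - (g ^ 2 - 2 * inner ℝ nv (A (Xs - X))) * h1
  have hfin : 2 * lam * (nucNorm X - nucNorm Xs) ≤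
      2 * lam * (2 * ∑ i ∈ Eᶜ, σ i + √k * (β₁ * g)) :=
    mul_le_mul_of_nonneg_left (by linarith) (by positivity)
  linarith
end

section
/- Let A : ℝ^{n₁×n₂} → ℝ^m be a linear map satisfying the RIP of order ⌈tk⌉ with restricted isometry constant δ_{tk} satisfying δ_{tk} < √((t−1)/t) for some fixed t > 1 and positive integer k. Let X ∈ ℝ^{n₁×n₂}, n ∈ ℝ^m with ‖n‖₂ ≤ ε, b = A(X) + n, λ > 0, let X♯ be a minimizer of Z ↦ ‖Z‖_* + (1/(2λ))‖b − A(Z)‖₂², set H = X♯ − X and E = {1,…,k}. Then ‖H_{E^c}‖_* ≤ √k·‖H_E‖_F + [2(√k·β₁·λ + 2ε)/(√k·β₁·λ + ε)]·‖X_{E^c}‖_* + (2ε/λ)(√k·β₁·λ + ε), where β₁ = 2/((1−δ_{tk})√(1+δ_{tk})). -/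
open Finset

section Weyl

lemma inner_eq_zero_of_mem_orthogonal_span {V ι : Type*} [NormedAddCommGroup V]
    [InnerProductSpace ℝ V] {w : ι → V} {x : V}
    (hx : x ∈ (Submodule.span ℝ (Set.range w))ᗮ) (i : ι) : inner ℝ (w i) x = 0 :=
  Submodule.inner_right_of_mem_orthogonal (Submodule.subset_span (Set.mem_range_self i)) hx

lemma sum_sq_inner_le {V ι : Type*} [NormedAddCommGroup V] [InnerProductSpace ℝ V]
    [Fintype ι] {v : ι → V} (hv : Orthonormal ℝ v) (x : V) :
    ∑ i, inner ℝ (v i) x ^ 2 ≤ ‖x‖ ^ 2 := by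
  simpa using hv.sum_inner_products_le x (s := univ)

variable {V : Type*} [NormedAddCommGroup V] [InnerProductSpace ℝ V] [FiniteDimensional ℝ V]

/-- The easy half of the Courant–Fischer theorem. -/
lemma le_eigenvalues_of_lt_finrank {T : V →ₗ[ℝ] V} (hT : T.IsSymmetric) {N : ℕ}
    (hN : Module.finrank ℝ V = N) (W : Submodule ℝ V) (j : Fin N)
    (hj : (j : ℕ) < Module.finrank ℝ W) {a : ℝ}
    (h : ∀ x ∈ W, a * ‖x‖ ^ 2 ≤ inner ℝ x (T x)) : a ≤ hT.eigenvalues hN j := by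
  set e := hT.eigenvectorBasis hN with he
  let L : W →ₗ[ℝ] (Fin j → ℝ) :=
    LinearMap.pi fun i => (innerSL ℝ (e (i.castLE j.2.le))).toLinearMap ∘ₗ W.subtype
  have hker : LinearMap.ker L ≠ ⊥ := L.ker_ne_bot_of_finrank_lt (by simpa using hj)
  obtain ⟨⟨x, hxW⟩, hx, hx0⟩ := (Submodule.ne_bot_iff _).mp hker
  have hx0' : x ≠ 0 := fun hz => hx0 (by simp [hz])
  have horth : ∀ i : Fin N, i < j → inner ℝ (e i) x = 0 := fun i hi => by
    have := congrFun (LinearMap.mem_ker.mp hx) ⟨i, hi⟩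
    simpa [L] using this
  have hTx : inner ℝ x (T x) = ∑ i, hT.eigenvalues hN i * inner ℝ (e i) x ^ 2 := by
    rw [← e.sum_inner_mul_inner]
    refine sum_congr rfl fun i _ => ?_
    rw [← hT, he, hT.apply_eigenvectorBasis, inner_smul_left, real_inner_comm x]
    simp only [RCLike.ofReal_real_eq_id, id_eq, conj_trivial]
    ring
  have hle : inner ℝ x (T x) ≤ hT.eigenvalues hN j * ‖x‖ ^ 2 := by
    rw [hTx, ← e.sum_sq_inner_right x, mul_sum]
    refine sum_le_sum fun i _ => ?_
    rcases lt_or_ge i j with hij | hij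
    · simp [horth i hij]
    · exact mul_le_mul_of_nonneg_right (hT.eigenvalues_antitone hN hij) (sq_nonneg _)
  have hpos : 0 < ‖x‖ ^ 2 := by positivity
  exact le_of_mul_le_mul_right ((h x hxW).trans hle) hpos

variable {n : ℕ} {σ : Fin n → ℝ} {p q : Fin n → V} {T : V →ₗ[ℝ] V}

lemma top_le_eigenvalues (hT : T.IsSymmetric) {N : ℕ} (hN : Module.finrank ℝ V = N)
    (hσ0 : ∀ i, 0 ≤ σ i) (hσ : Antitone σ) (hpq : Orthonormal ℝ (Sum.elim p q))
    (hform : ∀ x, ∑ i, σ i * (inner ℝ (p i) x ^ 2 - inner ℝ (q i) x ^ 2) ≤ inner ℝ x (T x))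
    (i : Fin n) (j : Fin N) (hij : (j : ℕ) = i) : σ i ≤ hT.eigenvalues hN j := by
  have hp : Orthonormal ℝ p := hpq.comp Sum.inl Sum.inl_injective
  have hcross : ∀ l m, inner ℝ (q l) (p m) = 0 := fun l m =>
    hpq.inner_eq_zero (i := Sum.inr l) (j := Sum.inl m) (by simp)
  let w : Fin (i + 1) → V := fun l => p (l.castLE i.2)
  have hw : Orthonormal ℝ w := hp.comp _ (Fin.castLE_injective _)
  refine le_eigenvalues_of_lt_finrank hT hN (Submodule.span ℝ (Set.range w)) j ?_ fun x hx => ?_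
  · rw [finrank_span_eq_card hw.linearIndependent]
    simp [hij]
  · obtain ⟨c, rfl⟩ := (Submodule.mem_span_range_iff_exists_fun ℝ).mp hx
    refine le_trans ?_ (hform _)
    set x := ∑ l, c l • w l
    have hq : ∀ l, inner ℝ (q l) x = 0 := fun l => by
      simp [x, inner_sum, inner_smul_right, w, hcross]
    have hp0 : ∀ l, i < l → inner ℝ (p l) x = 0 := fun l hl => by
      simp only [x, inner_sum, inner_smul_right, w]
      refine sum_eq_zero fun m _ => ?_
      rw [hp.inner_eq_zero, mul_zero]
      intro h
      have h1 := m.2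
      have h2 : (l : ℕ) = m := congrArg Fin.val h
      have h3 : (i : ℕ) < l := hl
      omega
    have hnorm : ‖x‖ ^ 2 ≤ ∑ l, inner ℝ (p l) x ^ 2 := by
      have h1 : ‖x‖ ^ 2 = ∑ l, inner ℝ (w l) x ^ 2 := by
        rw [← real_inner_self_eq_norm_sq]
        conv_lhs => rw [show x = ∑ l, c l • w l from rfl]
        rw [hw.inner_sum]
        refine sum_congr rfl fun l _ => ?_
        rw [hw.inner_right_fintype]
        simp [sq]
      rw [h1]
      have := sum_le_univ_sum_of_nonneg (s := univ.image (Fin.castLE i.2 : Fin (i + 1) → Fin n))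
        (f := fun l => inner ℝ (p l) x ^ 2) (fun l => sq_nonneg _)
      rwa [sum_image (fun _ _ _ _ h => Fin.castLE_injective _ h)] at this
    calc σ i * ‖x‖ ^ 2 ≤ σ i * ∑ l, inner ℝ (p l) x ^ 2 :=
          mul_le_mul_of_nonneg_left hnorm (hσ0 i)
      _ ≤ _ := by
        rw [mul_sum]
        refine sum_le_sum fun l _ => ?_
        rw [hq l]
        rcases lt_or_ge i l with hl | hl
        · simp [hp0 l hl]
        · nlinarith [hσ hl, sq_nonneg (inner ℝ (p l) x)]

lemma finrank_orthogonal_span_ge {m N : ℕ} (hN : Module.finrank ℝ V = N) (w : Fin m → V) :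
    N - m ≤ Module.finrank ℝ (Submodule.span ℝ (Set.range w))ᗮ := by
  have h1 := (Submodule.span ℝ (Set.range w)).finrank_add_finrank_orthogonal
  have h2 := finrank_range_le_card (R := ℝ) w
  rw [Set.finrank, Fintype.card_fin] at h2
  omega

lemma nonneg_eigenvalues (hT : T.IsSymmetric) {N : ℕ} (hN : Module.finrank ℝ V = N)
    (hσ0 : ∀ i, 0 ≤ σ i)
    (hform : ∀ x, ∑ i, σ i * (inner ℝ (p i) x ^ 2 - inner ℝ (q i) x ^ 2) ≤ inner ℝ x (T x))
    (j : Fin N) (hj : (j : ℕ) + n < N) : 0 ≤ hT.eigenvalues hN j := by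
  refine le_eigenvalues_of_lt_finrank hT hN (Submodule.span ℝ (Set.range q))ᗮ j ?_ fun x hx => ?_
  · have := finrank_orthogonal_span_ge hN q
    omega
  · rw [zero_mul]
    refine le_trans (sum_nonneg fun i _ => ?_) (hform x)
    rw [inner_eq_zero_of_mem_orthogonal_span (w := q) hx]
    exact mul_nonneg (hσ0 i) (by simp [sq_nonneg])

lemma neg_le_eigenvalues (hT : T.IsSymmetric) {N : ℕ} (hN : Module.finrank ℝ V = N)
    (hσ0 : ∀ i, 0 ≤ σ i) (hσ : Antitone σ) (hq : Orthonormal ℝ q)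
    (hform : ∀ x, ∑ i, σ i * (inner ℝ (p i) x ^ 2 - inner ℝ (q i) x ^ 2) ≤ inner ℝ x (T x))
    (i : Fin n) (j : Fin N) (hij : (j : ℕ) + i < N) : -σ i ≤ hT.eigenvalues hN j := by
  let w : Fin i → V := fun l => q (l.castLE i.2.le)
  refine le_eigenvalues_of_lt_finrank hT hN (Submodule.span ℝ (Set.range w))ᗮ j ?_ fun x hx => ?_
  · have := finrank_orthogonal_span_ge hN w
    omega
  · refine le_trans ?_ (hform x)
    have hB := mul_le_mul_of_nonneg_left (sum_sq_inner_le hq x) (hσ0 i)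
    rw [mul_sum] at hB
    rw [neg_mul, neg_le]
    refine le_trans ?_ hB
    rw [← sum_neg_distrib]
    refine sum_le_sum fun l _ => ?_
    rcases lt_or_ge l i with hl | hl
    · have : inner ℝ (q l) x = 0 :=
        inner_eq_zero_of_mem_orthogonal_span (ι := Fin i) hx ⟨l, hl⟩
      rw [this]
      have := hσ0 l
      simp only [ne_eq, OfNat.ofNat_ne_zero, not_false_eq_true, zero_pow, sub_zero, mul_zero]
      nlinarith [sq_nonneg (inner ℝ (p l) x)]
    · nlinarith [hσ hl, hσ0 l, sq_nonneg (inner ℝ (p l) x), sq_nonneg (inner ℝ (q l) x)]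

/-- A trace inequality of Lidskii type: a symmetric operator dominating two quadratic forms with
spectra `±σ` and `±τ` (and zeros) has trace at least the signed sum of the gaps. -/
lemma lidskii_trace_le {τ : Fin n → ℝ} {p' q' : Fin n → V} {r : ℕ}
    (hT : T.IsSymmetric) (hN : Module.finrank ℝ V = n + r + n)
    (hσ0 : ∀ i, 0 ≤ σ i) (hσ : Antitone σ) (hpq : Orthonormal ℝ (Sum.elim p q))
    (hform : ∀ x, ∑ i, σ i * (inner ℝ (p i) x ^ 2 - inner ℝ (q i) x ^ 2) ≤ inner ℝ x (T x))
    (hτ0 : ∀ i, 0 ≤ τ i) (hτ : Antitone τ) (hpq' : Orthonormal ℝ (Sum.elim p' q'))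
    (hform' : ∀ x, ∑ i, τ i * (inner ℝ (p' i) x ^ 2 - inner ℝ (q' i) x ^ 2) ≤ inner ℝ x (T x))
    (E : Finset (Fin n)) :
    ∑ i ∈ E, (σ i - τ i) + ∑ i ∈ Eᶜ, (τ i - σ i) ≤ LinearMap.trace ℝ V T := by
  have htr := hT.trace_eq_sum_eigenvalues hN
  simp only [RCLike.ofReal_real_eq_id, id_eq] at htr
  rw [htr, Fin.sum_univ_add, Fin.sum_univ_add]
  have hmid : 0 ≤ ∑ i : Fin r, hT.eigenvalues hN (Fin.castAdd n (Fin.natAdd n i)) :=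
    sum_nonneg fun i _ => nonneg_eigenvalues hT hN hσ0 hform _ (by simp)
  have hrev := Equiv.sum_comp (Fin.revPerm (n := n))
    fun i => hT.eigenvalues hN (Fin.natAdd (n + r) i)
  rw [← hrev]
  have key : ∑ i ∈ E, (σ i - τ i) + ∑ i ∈ Eᶜ, (τ i - σ i) ≤
      ∑ i, (hT.eigenvalues hN (Fin.castAdd n (Fin.castAdd r i)) +
        hT.eigenvalues hN (Fin.natAdd (n + r) (Fin.revPerm i))) := by
    rw [← sum_add_sum_compl E fun i => hT.eigenvalues hN (Fin.castAdd n (Fin.castAdd r i)) +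
        hT.eigenvalues hN (Fin.natAdd (n + r) (Fin.revPerm i))]
    have htop := fun i => top_le_eigenvalues hT hN hσ0 hσ hpq hform i
      (Fin.castAdd n (Fin.castAdd r i)) (by simp)
    have htop' := fun i => top_le_eigenvalues hT hN hτ0 hτ hpq' hform' i
      (Fin.castAdd n (Fin.castAdd r i)) (by simp)
    have hbot := fun i : Fin n => neg_le_eigenvalues hT hN hσ0 hσ
      (hpq.comp Sum.inr Sum.inr_injective) hform i
      (Fin.natAdd (n + r) (Fin.revPerm i)) (by simp [Fin.val_rev]; omega)
    have hbot' := fun i : Fin n => neg_le_eigenvalues hT hN hτ0 hτ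
      (hpq'.comp Sum.inr Sum.inr_injective) hform' i
      (Fin.natAdd (n + r) (Fin.revPerm i)) (by simp [Fin.val_rev]; omega)
    refine add_le_add (sum_le_sum fun i _ => ?_) (sum_le_sum fun i _ => ?_)
    · linarith [htop i, hbot' i]
    · linarith [htop' i, hbot i]
  rw [sum_add_distrib] at key
  linarith

end Weyl

section NuclearNorm

open Matrix

variable {n₁ n₂ : ℕ}

lemma sum_rank1_eq (σ : Fin n₁ → ℝ) (u : Fin n₁ → Fin n₁ → ℝ) (v : Fin n₁ → Fin n₂ → ℝ) :
    ∑ i, rank1 (σ i) (u i) (v i) = (Matrix.of u)ᵀ * diagonal σ * Matrix.of v := by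
  ext a b
  rw [Matrix.sum_apply, Matrix.mul_apply]
  refine sum_congr rfl fun i _ => ?_
  rw [mul_diagonal]
  simp only [rank1, Matrix.of_apply, Matrix.transpose_apply]
  ring

lemma of_mul_transpose_eq_one {ι κ : Type*} [Fintype ι] [DecidableEq κ] (u : κ → ι → ℝ)
    (hu : ∀ i j, ∑ a, u i a * u j a = if i = j then (1 : ℝ) else 0) :
    Matrix.of u * (Matrix.of u)ᵀ = 1 := by
  ext i j
  simp [Matrix.mul_apply, hu, Matrix.one_apply]

lemma nucNorm_eq_sum (M : Matrix (Fin n₁) (Fin n₂) ℝ)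
    (σ : Fin n₁ → ℝ) (u : Fin n₁ → Fin n₁ → ℝ) (v : Fin n₁ → Fin n₂ → ℝ)
    (hσ0 : ∀ i, 0 ≤ σ i)
    (hu : ∀ i j, ∑ a, u i a * u j a = if i = j then (1 : ℝ) else 0)
    (hv : ∀ i j, ∑ b, v i b * v j b = if i = j then (1 : ℝ) else 0)
    (hM : M = ∑ i, rank1 (σ i) (u i) (v i)) : nucNorm M = ∑ i, σ i := by
  have hMM : M * Mᴴ = (Matrix.of u)ᵀ * (diagonal (fun i => σ i ^ 2) * Matrix.of u) := by
    rw [hM, sum_rank1_eq]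
    simp only [conjTranspose_eq_transpose_of_trivial, transpose_mul, transpose_transpose,
      diagonal_transpose]
    calc _ = (Matrix.of u)ᵀ * (diagonal σ * (Matrix.of v * (Matrix.of v)ᵀ) * diagonal σ *
          Matrix.of u) := by simp only [Matrix.mul_assoc]
      _ = _ := by
        rw [of_mul_transpose_eq_one v hv, Matrix.mul_one, diagonal_mul_diagonal]
        simp only [sq]
  have hchar : (M * Mᴴ).charpoly = (diagonal fun i => σ i ^ 2).charpoly := by
    rw [hMM, charpoly_mul_comm, Matrix.mul_assoc, of_mul_transpose_eq_one u hu, Matrix.mul_one]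
  have hroots := (isHermitian_mul_conjTranspose_self M).roots_charpoly_eq_eigenvalues
  rw [hchar, charpoly_diagonal, Polynomial.roots_prod _ _
    (prod_ne_zero_iff.mpr fun i _ => Polynomial.X_sub_C_ne_zero _)] at hroots
  simp only [Polynomial.roots_X_sub_C, Multiset.bind_singleton] at hroots
  have hsum := congrArg (fun s => (s.map Real.sqrt).sum) hroots
  simp only [Multiset.map_map, Function.comp_def, Real.sqrt_sq (hσ0 _),
    RCLike.ofReal_real_eq_id, id_eq] at hsum
  exact hsum.symm

/-- A singular value decomposition of `D`, with zero right vectors allowed. -/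
lemma exists_nucNorm_decomposition (D : Matrix (Fin n₁) (Fin n₂) ℝ) :
    ∃ (s : Fin n₁ → ℝ) (w : Fin n₁ → Fin n₁ → ℝ) (z : Fin n₁ → Fin n₂ → ℝ),
      (∀ i, 0 ≤ s i) ∧ ∑ i, s i = nucNorm D ∧ (∀ i, w i ⬝ᵥ w i ≤ 1) ∧ (∀ i, z i ⬝ᵥ z i ≤ 1) ∧
        D = ∑ i, rank1 (s i) (w i) (z i) := by
  set hD := isHermitian_mul_conjTranspose_self D
  set μ := hD.eigenvalues
  let w : Fin n₁ → Fin n₁ → ℝ := fun i => (hD.eigenvectorBasis i).ofLp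
  let y : Fin n₁ → Fin n₂ → ℝ := fun i => w i ᵥ* D
  have hw : ∀ i, w i ⬝ᵥ w i = 1 := fun i => by
    have h := hD.eigenvectorBasis.orthonormal.1 i
    have h2 : inner ℝ (hD.eigenvectorBasis i) (hD.eigenvectorBasis i) = (1 : ℝ) := by
      rw [real_inner_self_eq_norm_sq, h, one_pow]
    rwa [EuclideanSpace.inner_eq_star_dotProduct, star_trivial] at h2
  have hμ : ∀ i, y i ⬝ᵥ y i = μ i := fun i => by
    have h := congrArg (fun x => w i ⬝ᵥ x) (hD.mulVec_eigenvectorBasis i)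
    have h2 : w i ⬝ᵥ (D * Dᴴ) *ᵥ w i = μ i * (w i ⬝ᵥ w i) := by
      rw [← smul_eq_mul, ← dotProduct_smul]
      exact h
    rw [hw, mul_one] at h2
    rw [← h2, ← Matrix.mulVec_mulVec, Matrix.dotProduct_mulVec,
      conjTranspose_eq_transpose_of_trivial, Matrix.mulVec_transpose]
  have hμ0 : ∀ i, 0 ≤ μ i := fun i => by
    rw [← hμ]
    exact sum_nonneg fun b _ => mul_self_nonneg _
  have hs : ∀ i, √(μ i) • ((√(μ i))⁻¹ • y i) = y i := fun i => by
    rcases eq_or_ne (√(μ i)) 0 with h | h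
    · have h0 : y i = 0 := by
        rw [← dotProduct_self_eq_zero, hμ]
        exact (Real.sqrt_eq_zero (hμ0 i)).mp h
      simp [h0]
    · rw [smul_smul, mul_inv_cancel₀ h, one_smul]
  refine ⟨fun i => √(μ i), w, fun i => (√(μ i))⁻¹ • y i, fun i => Real.sqrt_nonneg _, rfl,
    fun i => (hw i).le, fun i => ?_, ?_⟩
  · rw [smul_dotProduct, dotProduct_smul, hμ, smul_eq_mul, smul_eq_mul]
    nth_rewrite 3 [← Real.mul_self_sqrt (hμ0 i)]
    rw [← mul_assoc, ← mul_assoc, mul_assoc _ _ (√(μ i)), mul_assoc]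
    rcases eq_or_ne (√(μ i)) 0 with h | h
    · simp [h]
    · field_simp
      exact le_rfl
  · have hU : (hD.eigenvectorUnitary : Matrix (Fin n₁) (Fin n₁) ℝ) *
        ((hD.eigenvectorUnitary : Matrix (Fin n₁) (Fin n₁) ℝ)ᴴ * D) = D := by
      rw [← Matrix.mul_assoc, ← Matrix.star_eq_conjTranspose,
        Unitary.mul_star_self_of_mem hD.eigenvectorUnitary.2, Matrix.one_mul]
    ext a b
    conv_lhs => rw [← hU]
    rw [Matrix.sum_apply, Matrix.mul_apply]
    refine sum_congr rfl fun i _ => ?_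
    have h := congrFun (hs i) b
    simp only [Pi.smul_apply, smul_eq_mul] at h
    simp only [rank1, Matrix.of_apply, Pi.smul_apply, smul_eq_mul]
    rw [mul_right_comm, h, mul_comm]
    congr 1

/-- The vector `(u, v) / √2`. -/
noncomputable def stack (u : Fin n₁ → ℝ) (v : Fin n₂ → ℝ) :
    EuclideanSpace ℝ (Fin n₁ ⊕ Fin n₂) :=
  (√2)⁻¹ • WithLp.toLp 2 (Sum.elim u v)

lemma inner_stack (u : Fin n₁ → ℝ) (v : Fin n₂ → ℝ) (x : EuclideanSpace ℝ (Fin n₁ ⊕ Fin n₂)) :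
    inner ℝ (stack u v) x =
      (√2)⁻¹ * (u ⬝ᵥ (fun a => x (Sum.inl a)) + v ⬝ᵥ (fun b => x (Sum.inr b))) := by
  simp [stack, inner_smul_left, PiLp.inner_apply, dotProduct, mul_comm]

lemma inner_stack_stack (u u' : Fin n₁ → ℝ) (v v' : Fin n₂ → ℝ) :
    inner ℝ (stack u v) (stack u' v') = (u ⬝ᵥ u' + v ⬝ᵥ v') / 2 := by
  have h2 : (√2)⁻¹ * (√2)⁻¹ = (1 / 2 : ℝ) := by
    rw [← mul_inv, Real.mul_self_sqrt (by norm_num)]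
    norm_num
  have : ∀ {m : ℕ} (a b : Fin m → ℝ), (a ⬝ᵥ fun i => (√2)⁻¹ * b i) = (√2)⁻¹ * (a ⬝ᵥ b) :=
    fun a b => dotProduct_smul (√2)⁻¹ a b
  rw [inner_stack]
  simp only [stack, PiLp.smul_apply, Sum.elim_inl, Sum.elim_inr, smul_eq_mul, this]
  linear_combination (u ⬝ᵥ u' + v ⬝ᵥ v') * h2

lemma inner_stack_sq (u : Fin n₁ → ℝ) (v : Fin n₂ → ℝ)
    (x : EuclideanSpace ℝ (Fin n₁ ⊕ Fin n₂)) :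
    inner ℝ (stack u v) x ^ 2 =
      (u ⬝ᵥ (fun a => x (Sum.inl a)) + v ⬝ᵥ (fun b => x (Sum.inr b))) ^ 2 / 2 := by
  rw [inner_stack, mul_pow, inv_pow, Real.sq_sqrt (by norm_num)]
  ring

lemma orthonormal_stack (u : Fin n₁ → Fin n₁ → ℝ) (v : Fin n₁ → Fin n₂ → ℝ)
    (hu : ∀ i j, ∑ a, u i a * u j a = if i = j then (1 : ℝ) else 0)
    (hv : ∀ i j, ∑ b, v i b * v j b = if i = j then (1 : ℝ) else 0) :
    Orthonormal ℝ (Sum.elim (fun i => stack (u i) (v i)) fun i => stack (u i) (-v i)) := by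
  have hu' : ∀ i j, u i ⬝ᵥ u j = if i = j then (1 : ℝ) else 0 := hu
  have hv' : ∀ i j, v i ⬝ᵥ v j = if i = j then (1 : ℝ) else 0 := hv
  rw [orthonormal_iff_ite]
  rintro (i | i) (j | j) <;>
    simp only [Sum.elim_inl, Sum.elim_inr, inner_stack_stack, hu', hv', dotProduct_neg,
      neg_dotProduct, neg_neg, Sum.inl.injEq, Sum.inr.injEq, reduceCtorEq, if_false] <;>
    split_ifs <;> norm_num

lemma dotProduct_rank1_mulVec {ι : Type*} [Fintype ι] (s : ι → ℝ) (u : ι → Fin n₁ → ℝ)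
    (v : ι → Fin n₂ → ℝ) (a : Fin n₁ → ℝ) (b : Fin n₂ → ℝ) :
    a ⬝ᵥ (∑ i, rank1 (s i) (u i) (v i)) *ᵥ b = ∑ i, s i * ((u i ⬝ᵥ a) * (v i ⬝ᵥ b)) := by
  rw [Matrix.sum_mulVec, dotProduct_sum]
  refine sum_congr rfl fun i _ => ?_
  have h : rank1 (s i) (u i) (v i) *ᵥ b = (s i * (v i ⬝ᵥ b)) • u i := by
    ext c
    simp only [rank1, Matrix.mulVec, dotProduct, Matrix.of_apply, Pi.smul_apply, smul_eq_mul,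
      mul_sum, sum_mul]
    exact sum_congr rfl fun _ _ => by ring
  rw [h, dotProduct_smul, smul_eq_mul, dotProduct_comm a]
  ring

lemma sum_mul_inner_stack_sub (s : Fin n₁ → ℝ) (u : Fin n₁ → Fin n₁ → ℝ)
    (v : Fin n₁ → Fin n₂ → ℝ) (x : EuclideanSpace ℝ (Fin n₁ ⊕ Fin n₂)) :
    ∑ i, s i * (inner ℝ (stack (u i) (v i)) x ^ 2 - inner ℝ (stack (u i) (-v i)) x ^ 2) =
      2 * ((fun a => x (Sum.inl a)) ⬝ᵥ
        (∑ i, rank1 (s i) (u i) (v i)) *ᵥ fun b => x (Sum.inr b)) := by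
  rw [dotProduct_rank1_mulVec, mul_sum]
  refine sum_congr rfl fun i _ => ?_
  rw [inner_stack_sq, inner_stack_sq, neg_dotProduct]
  ring

/-- The **Mirsky inequality** for the nuclear norm, with prescribed signs. -/
lemma mirsky_nucNorm (hn : n₁ ≤ n₂) (X Y : Matrix (Fin n₁) (Fin n₂) ℝ)
    (σ : Fin n₁ → ℝ) (u : Fin n₁ → Fin n₁ → ℝ) (v : Fin n₁ → Fin n₂ → ℝ)
    (hσ0 : ∀ i, 0 ≤ σ i) (hσ : Antitone σ)
    (hu : ∀ i j, ∑ a, u i a * u j a = if i = j then (1 : ℝ) else 0)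
    (hv : ∀ i j, ∑ b, v i b * v j b = if i = j then (1 : ℝ) else 0)
    (hX : X = ∑ i, rank1 (σ i) (u i) (v i))
    (τ : Fin n₁ → ℝ) (u' : Fin n₁ → Fin n₁ → ℝ) (v' : Fin n₁ → Fin n₂ → ℝ)
    (hτ0 : ∀ i, 0 ≤ τ i) (hτ : Antitone τ)
    (hu' : ∀ i j, ∑ a, u' i a * u' j a = if i = j then (1 : ℝ) else 0)
    (hv' : ∀ i j, ∑ b, v' i b * v' j b = if i = j then (1 : ℝ) else 0)
    (hY : Y = ∑ i, rank1 (τ i) (u' i) (v' i)) (E : Finset (Fin n₁)) :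
    ∑ i ∈ E, (σ i - τ i) + ∑ i ∈ Eᶜ, (τ i - σ i) ≤ nucNorm (X - Y) := by
  obtain ⟨r, rfl⟩ := Nat.exists_eq_add_of_le hn
  obtain ⟨s, w, z, hs0, hs, hw, hz, hD⟩ := exists_nucNorm_decomposition (X - Y)
  let rk : EuclideanSpace ℝ (Fin n₁ ⊕ Fin (n₁ + r)) → EuclideanSpace ℝ (Fin n₁ ⊕ Fin (n₁ + r))
    →ₗ[ℝ] EuclideanSpace ℝ (Fin n₁ ⊕ Fin (n₁ + r)) :=
    fun x => (InnerProductSpace.rankOne ℝ x x).toLinearMap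
  have hrk : ∀ x, (rk x).IsSymmetric := fun x => InnerProductSpace.isSymmetric_rankOne_self x
  have hrk_apply : ∀ y x, inner ℝ x (rk y x) = inner ℝ y x ^ 2 := fun y x => by
    simp [rk, inner_smul_right, real_inner_comm, sq]
  have hrk_trace : ∀ x, LinearMap.trace ℝ _ (rk x) = inner ℝ x x := fun x =>
    InnerProductSpace.trace_rankOne x x
  have hsmul : ∀ (c : ℝ) {S : EuclideanSpace ℝ (Fin n₁ ⊕ Fin (n₁ + r)) →ₗ[ℝ]
      EuclideanSpace ℝ (Fin n₁ ⊕ Fin (n₁ + r))}, S.IsSymmetric → (c • S).IsSymmetric :=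
    fun c S hS => hS.smul (by simp)
  let T := ∑ i, (σ i • (rk (stack (u i) (v i)) - rk (stack (u i) (-v i))) +
    s i • rk (stack (w i) (-z i)))
  have hT : T.IsSymmetric := by
    refine LinearMap.isSymmetric_sum _ fun i _ => ?_
    exact (hsmul _ ((hrk _).sub (hrk _))).add (hsmul _ (hrk _))
  have hTx : ∀ x, inner ℝ x (T x) =
      ∑ i, σ i * (inner ℝ (stack (u i) (v i)) x ^ 2 - inner ℝ (stack (u i) (-v i)) x ^ 2) +
        ∑ i, s i * inner ℝ (stack (w i) (-z i)) x ^ 2 := fun x => by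
    rw [← sum_add_distrib]
    simp [T, LinearMap.sum_apply, inner_sum, inner_add_right, inner_smul_right, inner_sub_right,
      hrk_apply]
  have htr : LinearMap.trace ℝ _ T ≤ nucNorm (X - Y) := by
    rw [← hs]
    simp only [T, map_sum, map_add, map_smul, map_sub, hrk_trace, inner_stack_stack,
      dotProduct_neg, neg_dotProduct, neg_neg, sub_self, smul_eq_mul, mul_zero, zero_add]
    refine sum_le_sum fun i _ => ?_
    nlinarith [hw i, hz i, hs0 i]
  refine le_trans ?_ htr
  refine lidskii_trace_le (r := r) hT ?_ hσ0 hσ (orthonormal_stack u v hu hv) (fun x => ?_) hτ0 hτ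
    (orthonormal_stack u' v' hu' hv') (fun x => ?_) E
  · simp
    omega
  · rw [hTx]
    refine le_add_of_nonneg_right (sum_nonneg fun i _ => mul_nonneg (hs0 i) (sq_nonneg _))
  · rw [hTx, sum_mul_inner_stack_sub, sum_mul_inner_stack_sub, ← hX, ← hY]
    have hsplit := dotProduct_rank1_mulVec s w z (fun a => x (Sum.inl a)) fun b => x (Sum.inr b)
    rw [← hD] at hsplit
    have hadd : ∀ a b, a ⬝ᵥ X *ᵥ b = a ⬝ᵥ Y *ᵥ b + a ⬝ᵥ (X - Y) *ᵥ b := fun a b => by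
      rw [← dotProduct_add, ← Matrix.add_mulVec, add_sub_cancel]
    rw [hadd, hsplit, mul_add, add_assoc,
      le_add_iff_nonneg_right, mul_sum, ← sum_add_distrib]
    refine sum_nonneg fun i _ => ?_
    rw [inner_stack_sq, neg_dotProduct]
    nlinarith [mul_nonneg (hs0 i) (sq_nonneg (w i ⬝ᵥ (fun a => x (Sum.inl a)) +
      z i ⬝ᵥ fun b => x (Sum.inr b)))]

lemma frobNorm_sum_rank1_sq (E : Finset (Fin n₁)) (σ : Fin n₁ → ℝ) (u : Fin n₁ → Fin n₁ → ℝ)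
    (v : Fin n₁ → Fin n₂ → ℝ)
    (hu : ∀ i j, ∑ a, u i a * u j a = if i = j then (1 : ℝ) else 0)
    (hv : ∀ i j, ∑ b, v i b * v j b = if i = j then (1 : ℝ) else 0) :
    frobNorm (∑ i ∈ E, rank1 (σ i) (u i) (v i)) ^ 2 = ∑ i ∈ E, σ i ^ 2 := by
  have hsq : ∀ M : Matrix (Fin n₁) (Fin n₂) ℝ, frobNorm M ^ 2 = ∑ a, ∑ b, M a b ^ 2 := fun M =>
    Real.sq_sqrt (sum_nonneg fun _ _ => sum_nonneg fun _ _ => sq_nonneg _)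
  rw [hsq]
  calc _ = ∑ a, ∑ b, ∑ i ∈ E, ∑ j ∈ E,
        σ i * σ j * ((u i a * u j a) * (v i b * v j b)) := by
        refine sum_congr rfl fun a _ => sum_congr rfl fun b _ => ?_
        rw [Matrix.sum_apply, sq, sum_mul_sum]
        refine sum_congr rfl fun i _ => sum_congr rfl fun j _ => ?_
        simp only [rank1, Matrix.of_apply]
        ring
    _ = ∑ i ∈ E, ∑ j ∈ E, σ i * σ j * ((∑ a, u i a * u j a) * ∑ b, v i b * v j b) := by
        simp_rw [sum_mul_sum, mul_sum]
        calc _ = ∑ a, ∑ i ∈ E, ∑ j ∈ E, ∑ b,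
              σ i * σ j * ((u i a * u j a) * (v i b * v j b)) := by
              refine sum_congr rfl fun a _ => ?_
              rw [sum_comm]
              exact sum_congr rfl fun i _ => sum_comm
          _ = _ := by
              rw [sum_comm]
              exact sum_congr rfl fun i _ => sum_comm
    _ = _ := by
        refine sum_congr rfl fun i hi => ?_
        simp [hu, hv, hi, sq]

lemma sum_le_sqrt_mul_frobNorm {k : ℕ} (E : Finset (Fin n₁)) (hE : #E ≤ k) (σ : Fin n₁ → ℝ)
    (u : Fin n₁ → Fin n₁ → ℝ) (v : Fin n₁ → Fin n₂ → ℝ)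
    (hu : ∀ i j, ∑ a, u i a * u j a = if i = j then (1 : ℝ) else 0)
    (hv : ∀ i j, ∑ b, v i b * v j b = if i = j then (1 : ℝ) else 0) :
    ∑ i ∈ E, σ i ≤ √k * frobNorm (∑ i ∈ E, rank1 (σ i) (u i) (v i)) := by
  refine le_of_abs_le (abs_le_of_sq_le_sq ?_ (mul_nonneg (Real.sqrt_nonneg _) (Real.sqrt_nonneg _)))
  rw [mul_pow, Real.sq_sqrt (Nat.cast_nonneg k), frobNorm_sum_rank1_sq E σ u v hu hv]
  refine sq_sum_le_card_mul_sum_sq.trans ?_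
  gcongr

end NuclearNorm

theorem stmt12 {n₁ n₂ m k : ℕ} (hk : 0 < k) (hn : n₁ ≤ n₂)
    (A : Matrix (Fin n₁) (Fin n₂) ℝ →ₗ[ℝ] EuclideanSpace ℝ (Fin m))
    (t δ : ℝ) (ht : 1 < t) (hδ0 : 0 < δ)
    (hδ : δ < Real.sqrt ((t - 1) / t))
    (hRIP : HasRIP A ⌈t * (k : ℝ)⌉₊ δ)
    (X : Matrix (Fin n₁) (Fin n₂) ℝ)
    -- SVD of `X`, with singular values `σX` in decreasing order
    (σX : Fin n₁ → ℝ) (uX : Fin n₁ → Fin n₁ → ℝ) (vX : Fin n₁ → Fin n₂ → ℝ)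
    (hσX0 : ∀ i, 0 ≤ σX i) (hσXmono : ∀ i j : Fin n₁, i ≤ j → σX j ≤ σX i)
    (huX : ∀ i j, ∑ a, uX i a * uX j a = if i = j then (1 : ℝ) else 0)
    (hvX : ∀ i j, ∑ b, vX i b * vX j b = if i = j then (1 : ℝ) else 0)
    (hX : X = ∑ i, rank1 (σX i) (uX i) (vX i))
    (nv : EuclideanSpace ℝ (Fin m)) (ε : ℝ) (hnv : ‖nv‖ ≤ ε)
    (b : EuclideanSpace ℝ (Fin m)) (hb : b = A X + nv)
    (lam : ℝ) (hlam : 0 < lam)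
    (Xs : Matrix (Fin n₁) (Fin n₂) ℝ)
    (hXs : ∀ Z : Matrix (Fin n₁) (Fin n₂) ℝ,
      nucNorm Xs + (1 / (2 * lam)) * ‖b - A Xs‖ ^ 2 ≤
        nucNorm Z + (1 / (2 * lam)) * ‖b - A Z‖ ^ 2)
    -- SVD of `H = Xs - X`, with singular values `σH` in decreasing order
    (σH : Fin n₁ → ℝ) (uH : Fin n₁ → Fin n₁ → ℝ) (vH : Fin n₁ → Fin n₂ → ℝ)
    (hσH0 : ∀ i, 0 ≤ σH i) (hσHmono : ∀ i j : Fin n₁, i ≤ j → σH j ≤ σH i)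
    (huH : ∀ i j, ∑ a, uH i a * uH j a = if i = j then (1 : ℝ) else 0)
    (hvH : ∀ i j, ∑ b, vH i b * vH j b = if i = j then (1 : ℝ) else 0)
    (hH : Xs - X = ∑ i, rank1 (σH i) (uH i) (vH i))
    -- `E = {1, …, k}`
    (E : Finset (Fin n₁)) (hEdef : E = univ.filter fun i : Fin n₁ => (i : ℕ) < k)
    (β₁ : ℝ) (hβ₁ : β₁ = 2 / ((1 - δ) * Real.sqrt (1 + δ))) :
    (∑ i ∈ Eᶜ, σH i) ≤
      Real.sqrt k * frobNorm (∑ i ∈ E, rank1 (σH i) (uH i) (vH i)) +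
        (2 * (Real.sqrt k * β₁ * lam + 2 * ε) / (Real.sqrt k * β₁ * lam + ε)) *
          (∑ i ∈ Eᶜ, σX i) +
        (2 * ε / lam) * (Real.sqrt k * β₁ * lam + ε) := by
  have hδ1 : δ < 1 := hδ.trans_le <| Real.sqrt_le_one.mpr <| by
    rw [div_le_one (by linarith)]
    linarith
  have hβ : 0 < β₁ := by
    rw [hβ₁]
    have : 0 < 1 - δ := by linarith
    positivity
  have hε : 0 ≤ ε := (norm_nonneg _).trans hnv
  have hc : 0 < √(k : ℝ) * β₁ * lam := by
    have : (0 : ℝ) < k := by exact_mod_cast hk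
    positivity
  have hcard : #E ≤ k := by
    rw [hEdef, Fin.card_filter_val_lt]
    exact min_le_right _ _
  have hEH := sum_le_sqrt_mul_frobNorm E hcard σH uH vH huH hvH
  have hXsX : Xs = X - ∑ i, rank1 (σH i) (-uH i) (vH i) := by
    have hneg : ∑ i, rank1 (σH i) (-uH i) (vH i) = -∑ i, rank1 (σH i) (uH i) (vH i) := by
      rw [← sum_neg_distrib]
      refine sum_congr rfl fun i _ => ?_
      ext a b
      simp [rank1]
    rw [hneg, ← hH]
    abel
  have hmirsky := mirsky_nucNorm hn X _ σX uX vX hσX0 hσXmono huX hvX hX σH (fun i => -uH i) vH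
    hσH0 hσHmono (by simpa using huH) hvH rfl E
  rw [← hXsX, sum_sub_distrib, sum_sub_distrib] at hmirsky
  have hmin := hXs X
  rw [nucNorm_eq_sum X σX uX vX hσX0 huX hvX hX, hb, add_sub_cancel_left,
    ← sum_add_sum_compl E] at hmin
  have hnoise : 1 / (2 * lam) * ‖nv‖ ^ 2 ≤ 2 * ε / lam * (√(k : ℝ) * β₁ * lam + ε) := by
    calc 1 / (2 * lam) * ‖nv‖ ^ 2 ≤ 1 / (2 * lam) * ε ^ 2 := by gcongr
      _ = 2 * ε / lam * (ε / 4) := by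
        field_simp
        ring
      _ ≤ _ := by
        gcongr
        linarith
  have hres : 0 ≤ 1 / (2 * lam) * ‖A X + nv - A Xs‖ ^ 2 := by positivity
  have hcoef : 2 * ∑ i ∈ Eᶜ, σX i ≤ 2 * (√(k : ℝ) * β₁ * lam + 2 * ε) /
      (√(k : ℝ) * β₁ * lam + ε) * ∑ i ∈ Eᶜ, σX i := by
    refine mul_le_mul_of_nonneg_right ?_ (sum_nonneg fun i _ => hσX0 i)
    rw [le_div_iff₀ (by linarith)]
    linarith
  linarith
end
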